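/- A word w over {a,b} is trapezoidal and not Sturmian if and only if w can be written as w = p·x·u·x·y·u·y·q, where u is a central word, {x,y} = {a,b} are the two distinct letters, and p, q are words such that π_{pxux} = π_{ux} and π_{yuyq} = π_{yu}. Moreover, for such a word, R_w = |pxux| and K_w = |yuyq|. -/

import Mathlib

/-- The two-letter alphabet {a, b}. -/
inductive AB : Type
  | a : AB
  | b : AB
deriving DecidableEq, Repr

/-- A (finite) word over {a, b}. -/
abbrev Word := List AB

open AB

/-- `u` occurs in `w` at position `i`. -/
def OccursAt (u w : Word) (i : ℕ) : Prop :=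
  i + u.length ≤ w.length ∧ (w.drop i).take u.length = u

/-- `u` occurs exactly once in `w` (is unrepeated in `w`). -/
def OccursOnce (u w : Word) : Prop := ∃! i, OccursAt u w i

/-- `u` is a right special factor of `w`: both `ua` and `ub` are factors of `w`. -/
def IsRightSpecial (u w : Word) : Prop := (u ++ [a]) <:+: w ∧ (u ++ [b]) <:+: w

/-- `u` is a left special factor of `w`: both `au` and `bu` are factors of `w`. -/
def IsLeftSpecial (u w : Word) : Prop := ([a] ++ u) <:+: w ∧ ([b] ++ u) <:+: w

/-- `K w`: the length of the shortest unrepeated suffix of `w`. -/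
noncomputable def Kp (w : Word) : ℕ := sInf {n | ∃ s : Word, s <:+ w ∧ s.length = n ∧ OccursOnce s w}

/-- `H w`: the length of the shortest unrepeated prefix of `w`. -/
noncomputable def Hp (w : Word) : ℕ := sInf {n | ∃ p : Word, p <+: w ∧ p.length = n ∧ OccursOnce p w}

/-- `R w`: the smallest `n ≥ 0` such that `w` has no right special factor of length `n`. -/
noncomputable def Rp (w : Word) : ℕ := sInf {n | ∀ u : Word, u.length = n → ¬ IsRightSpecial u w}

/-- `L w`: the smallest `n ≥ 0` such that `w` has no left special factor of length `n`. -/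
noncomputable def Lp (w : Word) : ℕ := sInf {n | ∀ u : Word, u.length = n → ¬ IsLeftSpecial u w}

/-- A word `w` is trapezoidal if `|w| = K w + R w`. -/
def IsTrapezoidal (w : Word) : Prop := w.length = Kp w + Rp w

/-- A finite word over `{a,b}` is Sturmian iff it is balanced: there is no word `u`
with both `aua` and `bub` factors of `w`. -/
def IsSturmian (w : Word) : Prop :=
  ¬ ∃ u : Word, ([a] ++ u ++ [a]) <:+: w ∧ ([b] ++ u ++ [b]) <:+: w

/-- A nonempty word is closed if it has a border (a proper prefix which is also a suffix)
whose only occurrences in `w` are as a prefix and as a suffix. -/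
def IsClosedWord (w : Word) : Prop :=
  w ≠ [] ∧ ∃ v : Word, v <+: w ∧ v.length < w.length ∧ v <:+ w ∧
    ∀ i : ℕ, OccursAt v w i → i = 0 ∨ i + v.length = w.length

/-- A nonempty word is open if it is not closed. -/
def IsOpenWord (w : Word) : Prop := w ≠ [] ∧ ¬ IsClosedWord w

/-- Central words: `a^n`, `b^n`, or `u a b v = v b a u`. -/
def IsCentral (w : Word) : Prop :=
  (∃ n : ℕ, w = List.replicate n a) ∨ (∃ n : ℕ, w = List.replicate n b) ∨
  (∃ u v : Word, w = u ++ [a, b] ++ v ∧ w = v ++ [b, a] ++ u)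

/-- The minimal period of `w`: `|w|` minus the length of the longest border of `w`. -/
noncomputable def minPeriod (w : Word) : ℕ :=
  w.length - sSup {n | ∃ v : Word, v.length = n ∧ v <+: w ∧ v ≠ w ∧ v <:+ w}

lemma isRightSpecial_iff {v w : Word} :
    IsRightSpecial v w ↔ ∃ c d : AB, c ≠ d ∧ v ++ [c] <:+: w ∧ v ++ [d] <:+: w := by
  constructor
  · rintro ⟨h₁, h₂⟩
    exact ⟨a, b, by simp, h₁, h₂⟩
  · rintro ⟨c, d, hcd, h₁, h₂⟩
    cases c <;> cases d <;> simp_all [IsRightSpecial]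

lemma occursAt_iff {u w : Word} {i : ℕ} :
    OccursAt u w i ↔ ∃ s t, w = s ++ u ++ t ∧ s.length = i := by
  constructor
  · rintro ⟨h₁, h₂⟩
    refine ⟨w.take i, (w.drop i).drop u.length, ?_, by simp; omega⟩
    conv_rhs => rw [List.append_assoc]; enter [2, 1]; rw [← h₂]
    rw [List.take_append_drop, List.take_append_drop]
  · rintro ⟨s, t, rfl, rfl⟩
    simp [OccursAt]

lemma occursOnce_iff_of_suffix {s w : Word} (hs : s <:+ w) :
    OccursOnce s w ↔ ∀ c, ¬ s ++ [c] <:+: w := by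
  obtain ⟨p, rfl⟩ := hs
  have hp : OccursAt s (p ++ s) p.length := occursAt_iff.2 ⟨p, [], by simp, rfl⟩
  constructor
  · rintro h c ⟨x, y, hxy⟩
    have hx : OccursAt s (p ++ s) x.length := occursAt_iff.2 ⟨x, c :: y, by simp [← hxy], rfl⟩
    have h₁ := h.unique hp hx
    have h₂ := congrArg List.length hxy
    simp at h₂
    omega
  · intro h
    refine ⟨p.length, hp, fun i hi => ?_⟩
    obtain ⟨x, t, hxt, rfl⟩ := occursAt_iff.1 hi
    cases t with
    | nil =>
      have h₂ := congrArg List.length hxt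
      simp at h₂
      omega
    | cons c t => exact absurd ⟨x, t, by simp [hxt]⟩ (h c)

/-- The suffix of `w` of length `n` occurs only once in `w`. -/
def UnrepeatedSuffix (w : Word) (n : ℕ) : Prop :=
  ∃ s, s <:+ w ∧ s.length = n ∧ ∀ c, ¬ s ++ [c] <:+: w

lemma Kp_eq (w : Word) : Kp w = sInf {n | UnrepeatedSuffix w n} := by
  unfold Kp UnrepeatedSuffix
  congr 1
  ext n
  refine exists_congr fun s => and_congr_right fun hs => and_congr_right fun _ => ?_
  exact occursOnce_iff_of_suffix hs

lemma unrepeatedSuffix_length (w : Word) : UnrepeatedSuffix w w.length := by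
  refine ⟨w, List.suffix_rfl, rfl, fun c h => ?_⟩
  have := h.length_le
  simp at this

lemma unrepeatedSuffix_Kp (w : Word) : UnrepeatedSuffix w (Kp w) := by
  rw [Kp_eq]
  exact Nat.sInf_mem (s := {n | UnrepeatedSuffix w n}) ⟨_, unrepeatedSuffix_length w⟩

lemma Kp_le {w : Word} {n : ℕ} (h : UnrepeatedSuffix w n) : Kp w ≤ n := by
  rw [Kp_eq]
  exact Nat.sInf_le h

lemma infix_append_of_suffix {s s' c w : Word} (h : s <:+ s') (hc : s' ++ c <:+: w) :
    s ++ c <:+: w := by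
  obtain ⟨p, rfl⟩ := h
  exact List.IsInfix.trans ⟨p, [], by simp⟩ hc

lemma exists_isRightSpecial_of_lt {w : Word} {n : ℕ} (h : n < Rp w) :
    ∃ u : Word, u.length = n ∧ IsRightSpecial u w := by
  simpa using Nat.notMem_of_lt_sInf h

lemma IsRightSpecial.of_suffix {s v w : Word} (h : IsRightSpecial v w) (hs : s <:+ v) :
    IsRightSpecial s w :=
  ⟨infix_append_of_suffix hs h.1, infix_append_of_suffix hs h.2⟩

lemma IsRightSpecial.length_lt {v w : Word} (h : IsRightSpecial v w) : v.length < w.length := by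
  have := h.1.length_le
  simp at this
  omega

lemma IsRightSpecial.length_lt_Rp {v w : Word} (h : IsRightSpecial v w) : v.length < Rp w := by
  by_contra! hle
  have hmem : Rp w ∈ {n | ∀ u : Word, u.length = n → ¬ IsRightSpecial u w} :=
    Nat.sInf_mem ⟨w.length, fun u hu hr => by have := hr.length_lt; omega⟩
  refine hmem (v.drop (v.length - Rp w)) (by simp; omega) ?_
  exact h.of_suffix (List.drop_suffix _ _)

lemma finite_setOf_isRightSpecial (w : Word) : {v | IsRightSpecial v w}.Finite := by
  have : Finite AB := Finite.of_surjective (fun c : Bool => if c then a else b) fun z => by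
    cases z
    · exact ⟨true, rfl⟩
    · exact ⟨false, rfl⟩
  refine (List.finite_length_le AB w.length).subset fun v hv => ?_
  exact (IsRightSpecial.length_lt hv).le

lemma exists_longest_repeated_prefix (z : AB) (w : Word) :
    ∃ (h : Word) (d : AB) (t : Word), z :: w = h ++ d :: t ∧ h <:+: w ∧
      ∀ v, v <+: z :: w → v <:+: w → v <+: h := by
  classical
  set n := Nat.findGreatest (fun n => (z :: w).take n <:+: w) w.length with hn
  have h₀ : (z :: w).take n <:+: w :=
    Nat.findGreatest_spec (P := fun n => (z :: w).take n <:+: w) (Nat.zero_le _) (by simp)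
  have hle : n ≤ w.length := Nat.findGreatest_le _
  refine ⟨(z :: w).take n, (z :: w)[n]'(by simp; omega), (z :: w).drop (n + 1), ?_, h₀, ?_⟩
  · rw [← List.drop_eq_getElem_cons, List.take_append_drop]
  · intro v hv hvw
    have hv' : (z :: w).take v.length = v := (List.prefix_iff_eq_take.1 hv).symm
    have : v.length ≤ n := Nat.le_findGreatest hvw.length_le (by rwa [hv'])
    rw [← hv']
    exact List.take_prefix_take_left (h := this)

lemma ncard_isRightSpecial_add_Kp (w : Word) :
    {v | IsRightSpecial v w}.ncard + Kp w = w.length := by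
  induction w with
  | nil =>
    have h₁ : {v | IsRightSpecial v ([] : Word)} = ∅ := by
      ext v
      simp [IsRightSpecial]
    have h₂ := Kp_le (unrepeatedSuffix_length [])
    simp at h₂
    simp [h₁, h₂]
  | cons z w ih =>
    obtain ⟨h, d, t, hzw, hw, hmax⟩ := exists_longest_repeated_prefix z w
    have hlen := congrArg List.length hzw
    simp at hlen
    have hd : ¬ h ++ [d] <:+: w := fun hd => by
      have := (hmax (h ++ [d]) ⟨t, by simp [hzw]⟩ hd).length_le
      simp at this
    have hhd : h ++ [d] <:+: z :: w := ⟨[], t, by simp [hzw]⟩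
    have mono : ∀ {v : Word}, v <:+: w → v <:+: z :: w := fun h => List.infix_cons h
    have pref : ∀ {v : Word} {c : AB}, v ++ [c] <:+: z :: w → ¬ v ++ [c] <:+: w →
        v ++ [c] <+: z :: w ∧ h <+: v := by
      intro v c h₁ h₂
      have h₃ := (List.infix_cons_iff.1 h₁).resolve_right h₂
      refine ⟨h₃, ?_⟩
      have hh : h <+: z :: w := ⟨d :: t, by simp [hzw]⟩
      have : h.length < (v ++ [c]).length := by
        by_contra! hle
        exact h₂ ((List.prefix_of_prefix_length_le h₃ hh hle).isInfix.trans hw)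
      have hv : v <+: z :: w := (List.prefix_append v [c]).trans h₃
      exact List.prefix_of_prefix_length_le hh hv (by simp at this; omega)
    have key : ∀ v, IsRightSpecial v (z :: w) ↔
        IsRightSpecial v w ∨ (v = h ∧ ∃ c, h ++ [c] <:+: w) := by
      intro v
      simp only [isRightSpecial_iff]
      constructor
      · rintro ⟨c, c', hne, h₁, h₂⟩
        by_cases h₃ : v ++ [c] <:+: w <;> by_cases h₄ : v ++ [c'] <:+: w
        · exact .inl ⟨c, c', hne, h₃, h₄⟩
        · right
          obtain ⟨h₅, h₆⟩ := pref h₂ h₄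
          have h₇ := hmax v ((List.prefix_append v [c']).trans h₅)
            (List.IsInfix.trans ⟨[], [c], rfl⟩ h₃)
          obtain rfl := h₇.eq_of_length_le h₆.length_le
          exact ⟨rfl, c, h₃⟩
        · right
          obtain ⟨h₅, h₆⟩ := pref h₁ h₃
          have h₇ := hmax v ((List.prefix_append v [c]).trans h₅)
            (List.IsInfix.trans ⟨[], [c'], rfl⟩ h₄)
          obtain rfl := h₇.eq_of_length_le h₆.length_le
          exact ⟨rfl, c', h₄⟩
        · have h₅ := (pref h₁ h₃).1
          have h₆ := (pref h₂ h₄).1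
          have := List.prefix_of_prefix_length_le h₅ h₆ (by simp)
          have := this.eq_of_length (by simp)
          simp at this
          exact absurd this hne
      · rintro (⟨c, c', hne, h₁, h₂⟩ | ⟨rfl, c, hc⟩)
        · exact ⟨c, c', hne, mono h₁, mono h₂⟩
        · refine ⟨c, d, ?_, mono hc, hhd⟩
          rintro rfl
          exact hd hc
    have hKle : Kp w ≤ Kp (z :: w) := by
      obtain ⟨s, hs, hsl, hsu⟩ := unrepeatedSuffix_Kp (z :: w)
      rcases List.suffix_cons_iff.1 hs with rfl | hs'
      · rw [← hsl]
        exact (Kp_le (unrepeatedSuffix_length w)).trans (by simp)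
      · rw [← hsl]
        exact Kp_le ⟨s, hs', rfl, fun c hc => hsu c (mono hc)⟩
    obtain ⟨s, hs, hsl, hsu⟩ := unrepeatedSuffix_Kp w
    by_cases hc : ∃ c, h ++ [c] <:+: w
    · have hset : {v | IsRightSpecial v (z :: w)} = insert h {v | IsRightSpecial v w} := by
        ext v
        simp [key, hc, or_comm]
      have hnot : h ∉ {v | IsRightSpecial v w} := by
        rintro ⟨h₁, h₂⟩
        cases d
        · exact hd h₁
        · exact hd h₂
      have hK : Kp (z :: w) ≤ Kp w := by
        refine Kp_le ⟨s, hs.trans (List.suffix_cons z w), hsl, fun c' hc' => ?_⟩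
        obtain ⟨h₁, h₂⟩ := pref hc' (hsu c')
        have h₃ := hmax s ((List.prefix_append s [c']).trans h₁) hs.isInfix
        obtain rfl := h₃.eq_of_length_le h₂.length_le
        obtain ⟨c, hc⟩ := hc
        exact hsu c hc
      rw [hset, Set.ncard_insert_of_notMem hnot (finite_setOf_isRightSpecial w)]
      simp
      omega
    · have hset : {v | IsRightSpecial v (z :: w)} = {v | IsRightSpecial v w} := by
        ext v
        simp [key, hc]
      have hhs : h <:+ w := by
        obtain ⟨x, y, hxy⟩ := hw
        cases y with
        | nil => exact ⟨x, by simpa using hxy⟩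
        | cons c y => exact absurd ⟨c, x, y, by simpa using hxy⟩ hc
      have hKh : Kp w = h.length := by
        refine le_antisymm (Kp_le ⟨h, hhs, rfl, fun c h' => hc ⟨c, h'⟩⟩) ?_
        by_contra! hlt
        have hsh : s <:+ h := List.suffix_of_suffix_length_le hs hhs (by omega)
        cases h with
        | nil => simp at hlt
        | cons z' h =>
          simp at hzw hlt
          have hs' : s <:+ h := by
            rcases List.suffix_cons_iff.1 hsh with rfl | hs'
            · simp at hsl
              omega
            · exact hs'
          refine hsu d (infix_append_of_suffix hs' ?_)
          exact ⟨[], t, by simp [hzw.2]⟩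
      have hK₁ : Kp (z :: w) ≤ h.length + 1 := by
        obtain ⟨x, hx⟩ := hhs
        have hxl := congrArg List.length hx
        simp at hxl
        have hsuf : (z :: x).drop x.length ++ h <:+ z :: w := by
          refine ⟨(z :: x).take x.length, ?_⟩
          rw [← List.append_assoc, List.take_append_drop, ← hx]
          simp
        refine Kp_le ⟨_, hsuf, by simp; omega, fun c h' => ?_⟩
        by_cases h₁ : ((z :: x).drop x.length ++ h) ++ [c] <:+: w
        · exact hc ⟨c, infix_append_of_suffix (List.suffix_append _ _) h₁⟩
        · obtain ⟨h₂, h₃⟩ := pref h' h₁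
          have h₄ := h'.length_le
          have h₅ := List.suffix_of_suffix_length_le hsuf (List.suffix_cons z w)
            (by simp at h₄ ⊢; omega)
          have h₆ := (hmax _ ((List.prefix_append _ [c]).trans h₂) h₅.isInfix).length_le
          simp at h₆
      have hK₂ : h.length + 1 ≤ Kp (z :: w) := by
        by_contra! hlt
        obtain ⟨s', hs', hsl', hsu'⟩ := unrepeatedSuffix_Kp (z :: w)
        have hhz : h <:+ z :: w := hhs.trans (List.suffix_cons z w)
        have := List.suffix_of_suffix_length_le hs' hhz (by omega)
        exact hsu' d (infix_append_of_suffix this hhd)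
      rw [hset]
      simp
      omega

lemma image_length_isRightSpecial (w : Word) :
    List.length '' {v | IsRightSpecial v w} = Set.Iio (Rp w) := by
  ext n
  simp only [Set.mem_image, Set.mem_ofPred_eq, Set.mem_Iio]
  constructor
  · rintro ⟨v, hv, rfl⟩
    exact hv.length_lt_Rp
  · intro hn
    obtain ⟨u, rfl, hu⟩ := exists_isRightSpecial_of_lt hn
    exact ⟨u, hu, rfl⟩

lemma Rp_add_Kp_le (w : Word) : Rp w + Kp w ≤ w.length := by
  have h₁ := Set.ncard_image_le (f := List.length) (finite_setOf_isRightSpecial w)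
  have h₂ := ncard_isRightSpecial_add_Kp w
  rw [image_length_isRightSpecial] at h₁
  simp at h₁
  omega

lemma isTrapezoidal_iff_injOn (w : Word) :
    IsTrapezoidal w ↔ Set.InjOn List.length {v | IsRightSpecial v w} := by
  have h₁ := image_length_isRightSpecial w
  have h₂ : {v : List AB | IsRightSpecial v w}.ncard + Kp w = w.length :=
    ncard_isRightSpecial_add_Kp w
  have h₃ : (Set.Iio (Rp w)).ncard = Rp w := by simp
  constructor
  · intro h
    refine Set.injOn_of_ncard_image_eq ?_ (finite_setOf_isRightSpecial w)
    unfold IsTrapezoidal at h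
    rw [h₁, h₃]
    omega
  · intro h
    have h₄ := h.ncard_image
    rw [h₁, h₃] at h₄
    unfold IsTrapezoidal
    omega

/-- The word `f i, f (i + 1), …, f (i + n - 1)`. -/
def window (f : ℤ → AB) (i : ℤ) : ℕ → Word
  | 0 => []
  | n + 1 => f i :: window f (i + 1) n

@[simp]
lemma length_window (f : ℤ → AB) (i : ℤ) (n : ℕ) : (window f i n).length = n := by
  induction n generalizing i with
  | zero => rfl
  | succ n ih => simp [window, ih]

lemma window_add (f : ℤ → AB) (i : ℤ) (m n : ℕ) :
    window f i (m + n) = window f i m ++ window f (i + m) n := by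
  induction m generalizing i with
  | zero => simp [window]
  | succ m ih =>
    rw [show m + 1 + n = (m + n) + 1 by omega]
    simp only [window, ih, List.cons_append]
    push_cast
    rw [show i + 1 + (m : ℤ) = i + (m + 1) by ring]

lemma window_one (f : ℤ → AB) (i : ℤ) : window f i 1 = [f i] := rfl

lemma getElem_window (f : ℤ → AB) (i : ℤ) (n t : ℕ) (h : t < (window f i n).length) :
    (window f i n)[t] = f (i + t) := by
  induction n generalizing i t with
  | zero => simp at h
  | succ n ih =>
    cases t with
    | zero => simp [window]
    | succ t =>
      simp only [window, List.getElem_cons_succ, ih]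
      push_cast
      rw [show i + 1 + (t : ℤ) = i + (t + 1) by ring]

/-- The windows of length `l` of `f` starting at `i` and `j` are equal. -/
def Agree (f : ℤ → AB) (i j l : ℤ) : Prop := ∀ t, 0 ≤ t → t < l → f (i + t) = f (j + t)

lemma window_eq_iff {f : ℤ → AB} {i j : ℤ} {n : ℕ} :
    window f i n = window f j n ↔ Agree f i j n := by
  constructor
  · intro h t h₀ h₁
    lift t to ℕ using h₀
    have h₂ := getElem_window f i n t (by simpa using h₁)
    rw [← h₂, ← getElem_window f j n t (by simpa using h₁)]
    simp [h]
  · intro h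
    refine List.ext_getElem (by simp) fun t h₁ h₂ => ?_
    rw [getElem_window, getElem_window]
    exact h t (by omega) (by simpa using h₁)

lemma exists_eq_window (w : Word) (c : ℤ) : ∃ f, w = window f c w.length := by
  refine ⟨fun i => w.getD (i - c).toNat a, List.ext_getElem (by simp) fun t h₁ h₂ => ?_⟩
  rw [getElem_window]
  simp [h₁]

lemma append_eq_window {f : ℤ → AB} {i : ℤ} {n : ℕ} {u v : Word} (h : u ++ v = window f i n) :
    u = window f i u.length ∧ v = window f (i + u.length) v.length := by
  have hn := congrArg List.length h
  simp at hn
  rw [← hn, window_add] at h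
  exact List.append_inj h (by simp)

lemma infix_window_iff {f : ℤ → AB} {i : ℤ} {n : ℕ} {v : Word} :
    v <:+: window f i n ↔
      ∃ j, i ≤ j ∧ j + v.length ≤ i + n ∧ v = window f j v.length := by
  constructor
  · rintro ⟨s, t, h⟩
    have hn := congrArg List.length h
    simp at hn
    have h₁ := append_eq_window (append_eq_window h).1.symm.symm
    exact ⟨i + s.length, by omega, by omega, h₁.2⟩
  · rintro ⟨j, h₁, h₂, h₃⟩
    obtain ⟨k, rfl⟩ := Int.le.dest h₁
    obtain ⟨m, rfl⟩ := Nat.exists_eq_add_of_le (show k + v.length ≤ n by omega)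
    rw [window_add, window_add, ← h₃]
    exact ⟨_, _, rfl⟩

/-- The equal windows of length `l` starting at `i` and `j` are continued by different letters
inside the interval `[lo, hi)`. -/
structure Branch (f : ℤ → AB) (lo hi l i j : ℤ) : Prop where
  le_left : lo ≤ i
  le_right : lo ≤ j
  left_lt : i + l < hi
  right_lt : j + l < hi
  agree : Agree f i j l
  ne : f (i + l) ≠ f (j + l)

/-- On the interval `[lo, hi)` there is at most one right special factor of each length. -/
def UniqueBranch (f : ℤ → AB) (lo hi : ℤ) : Prop :=
  ∀ ⦃l i j i' j'⦄, 0 ≤ l → Branch f lo hi l i j → Branch f lo hi l i' j' → Agree f i i' l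

lemma isRightSpecial_window_iff {f : ℤ → AB} {lo : ℤ} {n : ℕ} {v : Word} :
    IsRightSpecial v (window f lo n) ↔
      ∃ i j, v = window f i v.length ∧ Branch f lo (lo + n) v.length i j := by
  rw [isRightSpecial_iff]
  constructor
  · rintro ⟨c, d, hcd, h₁, h₂⟩
    obtain ⟨i, hi₁, hi₂, hi₃⟩ := infix_window_iff.1 h₁
    obtain ⟨j, hj₁, hj₂, hj₃⟩ := infix_window_iff.1 h₂
    obtain ⟨hi₄, hi₅⟩ := append_eq_window hi₃
    obtain ⟨hj₄, hj₅⟩ := append_eq_window hj₃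
    simp [window] at hi₂ hj₂ hi₅ hj₅
    refine ⟨i, j, hi₄, hi₁, hj₁, by omega, by omega, ?_, by rwa [← hi₅, ← hj₅]⟩
    rw [← window_eq_iff, ← hi₄, ← hj₄]
  · rintro ⟨i, j, hv, h⟩
    have hv' : v = window f j v.length := hv.trans (window_eq_iff.2 h.agree)
    refine ⟨_, _, h.ne, infix_window_iff.2 ⟨i, h.le_left, ?_, ?_⟩,
      infix_window_iff.2 ⟨j, h.le_right, ?_, ?_⟩⟩
    · have := h.left_lt
      simp
      omega
    · rw [List.length_append, window_add, ← hv]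
      rfl
    · have := h.right_lt
      simp
      omega
    · rw [List.length_append, window_add, ← hv']
      rfl

lemma isTrapezoidal_window_iff {f : ℤ → AB} {lo : ℤ} {n : ℕ} :
    IsTrapezoidal (window f lo n) ↔ UniqueBranch f lo (lo + n) := by
  rw [isTrapezoidal_iff_injOn]
  constructor
  · intro h l i j i' j' hl h₁ h₂
    lift l to ℕ using hl
    rw [← window_eq_iff]
    exact h (isRightSpecial_window_iff.2 ⟨i, j, by simp, by simpa using h₁⟩)
      (isRightSpecial_window_iff.2 ⟨i', j', by simp, by simpa using h₂⟩) (by simp)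
  · intro h u hu v hv huv
    obtain ⟨i, j, h₁, h₂⟩ := isRightSpecial_window_iff.1 hu
    obtain ⟨i', j', h₃, h₄⟩ := isRightSpecial_window_iff.1 hv
    rw [h₁, h₃, ← huv, window_eq_iff]
    exact h (by omega) h₂ (huv ▸ h₄)

lemma unrepeatedSuffix_window_iff {f : ℤ → AB} {lo : ℤ} {n k : ℕ} :
    UnrepeatedSuffix (window f lo n) k ↔
      k ≤ n ∧ ∀ i, lo ≤ i → i + k < lo + n → ¬ Agree f i (lo + n - k) k := by
  have hsuf : k ≤ n → window f (lo + n - k) k <:+ window f lo n := by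
    intro hk
    obtain ⟨m, rfl⟩ := Nat.exists_eq_add_of_le' hk
    rw [window_add]
    push_cast
    rw [show lo + (m + k : ℤ) - k = lo + m by ring]
    exact List.suffix_append _ _
  constructor
  · rintro ⟨s, hs, rfl, h⟩
    have hk : s.length ≤ n := by simpa using hs.length_le
    refine ⟨hk, fun i h₁ h₂ h₃ => h (f (i + s.length)) ?_⟩
    have h₄ : s = window f (lo + n - s.length) s.length :=
      (List.suffix_of_suffix_length_le hs (hsuf hk) (by simp)).eq_of_length (by simp)
    refine infix_window_iff.2 ⟨i, h₁, by simp; omega, ?_⟩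
    rw [List.length_append, window_add, window_eq_iff.2 h₃, ← h₄]
    rfl
  · rintro ⟨hk, h⟩
    refine ⟨_, hsuf hk, by simp, fun c hc => ?_⟩
    obtain ⟨i, h₁, h₂, h₃⟩ := infix_window_iff.1 hc
    simp at h₂
    refine h i h₁ (by omega) ?_
    rw [← window_eq_iff]
    simpa using (append_eq_window h₃).1.symm

lemma Branch.lt_Rp {f : ℤ → AB} {lo i j : ℤ} {n l : ℕ} (h : Branch f lo (lo + n) l i j) :
    l < Rp (window f lo n) := by
  have := (isRightSpecial_window_iff (v := window f i l)).2
    ⟨i, j, by rw [length_window], by simpa using h⟩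
  simpa using this.length_lt_Rp

lemma UnrepeatedSuffix.mono {w : Word} {m n : ℕ} (h : UnrepeatedSuffix w m) (hmn : m ≤ n)
    (hn : n ≤ w.length) : UnrepeatedSuffix w n := by
  obtain ⟨s, hs, rfl, hu⟩ := h
  refine ⟨w.drop (w.length - n), List.drop_suffix _ _, by simp; omega, fun c hc => hu c ?_⟩
  refine infix_append_of_suffix ?_ hc
  exact List.suffix_of_suffix_length_le hs (List.drop_suffix _ _) (by simp; omega)

lemma lt_Kp_of_agree {f : ℤ → AB} {lo i : ℤ} {n k : ℕ} (hi : lo ≤ i) (hk : i + k < lo + n)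
    (h : Agree f i (lo + n - k) k) : k < Kp (window f lo n) := by
  by_contra! hle
  have h₁ := (unrepeatedSuffix_Kp (window f lo n)).mono hle (by simp; omega)
  exact (unrepeatedSuffix_window_iff.1 h₁).2 i hi hk h

lemma Branch.length_add_le {f : ℤ → AB} {lo hi l i j i' k : ℤ} (h : Branch f lo hi l i j)
    (hl : 0 ≤ l) (hk : 0 ≤ k) (hi' : lo ≤ i') (hk' : i' + k < hi) (h' : Agree f i' (hi - k) k) :
    l + k + 2 ≤ hi - lo := by
  lift l to ℕ using hl
  lift k to ℕ using hk
  obtain ⟨n, rfl⟩ := Int.le.dest (show lo ≤ hi by omega)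
  have h₁ := h.lt_Rp
  have h₂ := lt_Kp_of_agree hi' hk' h'
  have h₃ := Rp_add_Kp_le (window f lo n)
  simp at h₃
  omega

lemma UniqueBranch.exists_branch {f : ℤ → AB} {lo hi k : ℤ} (h : UniqueBranch f lo hi)
    (hk : 0 ≤ k) (hk' : k < hi - lo) (hu : ∀ i, lo ≤ i → i + k < hi → ¬ Agree f i (hi - k) k) :
    ∃ i j, Branch f lo hi (hi - lo - k - 1) i j := by
  lift k to ℕ using hk
  obtain ⟨n, rfl⟩ := Int.le.dest (show lo ≤ hi by omega)
  have h₁ := Kp_le (unrepeatedSuffix_window_iff.2 ⟨by omega, hu⟩)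
  have h₂ := isTrapezoidal_window_iff.2 h
  unfold IsTrapezoidal at h₂
  simp at h₂
  obtain ⟨u, hu₁, hu₂⟩ :=
    exists_isRightSpecial_of_lt (show n - k - 1 < Rp (window f lo n) by omega)
  obtain ⟨i, j, -, h₃⟩ := isRightSpecial_window_iff.1 hu₂
  refine ⟨i, j, ?_⟩
  rw [hu₁] at h₃
  convert h₃ using 1
  omega

lemma AB.eq_or_eq {x y : AB} (h : x ≠ y) (z : AB) : z = x ∨ z = y := by
  cases x <;> cases y <;> cases z <;> simp_all

section Agree

variable {f : ℤ → AB} {i j l : ℤ}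

lemma Agree.eq (h : Agree f i j l) {p q : ℤ} (h₁ : i ≤ p := by omega) (h₂ : p < i + l := by omega)
    (h₃ : q = j + (p - i) := by omega) : f p = f q := by
  have := h (p - i) (by omega) (by omega)
  rw [h₃, ← this]
  congr 1
  omega

lemma Agree.symm (h : Agree f i j l) : Agree f j i l := fun t h₁ h₂ => (h t h₁ h₂).symm

lemma Agree.mono (h : Agree f i j l) {i' j' l' : ℤ} (h₁ : i ≤ i' := by omega)
    (h₂ : i' + l' ≤ i + l := by omega) (h₃ : j' = j + (i' - i) := by omega) :
    Agree f i' j' l' := fun t h₄ h₅ => h.eq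

lemma Agree.trans (h : Agree f i j l) {p q : ℤ} (h' : Agree f p q l) (hp : p = j := by omega) :
    Agree f i q l := fun t h₁ h₂ => by
  subst hp
  exact (h t h₁ h₂).trans (h' t h₁ h₂)

lemma Agree.succ (h : Agree f i j l) {p q : ℤ} (he : f p = f q) (hp : p = i + l := by omega)
    (hq : q = j + l := by omega) : Agree f i j (l + 1) := by
  subst hp hq
  intro t h₁ h₂
  rcases eq_or_lt_of_le (show t ≤ l by omega) with rfl | h₃
  · exact he
  · exact h t h₁ h₃

lemma Agree.cons (h : Agree f (i + 1) (j + 1) l) (he : f i = f j) : Agree f i j (l + 1) := by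
  intro t h₁ h₂
  rcases eq_or_lt_of_le h₁ with rfl | h₃
  · simpa using he
  · exact h.eq

lemma Agree.eq_of_overlap (h : Agree f i (i + 1) l) (hl : 0 ≤ l) : f i = f (i + l) := by
  lift l to ℕ using hl
  induction l with
  | zero => simp
  | succ l ih =>
    push_cast at h ⊢
    rw [ih h.mono]
    exact h.eq

/-- A prefix of length `N` that reoccurs at two different shifts cannot be continued by the same
letter at both shifts and by another letter at the origin. -/
lemma Agree.false_of_two_shifts {c k₁ k₂ N : ℤ} (h₁ : Agree f (c + k₁) c N)
    (h₂ : Agree f (c + k₂) c N) (h₀ : 0 < k₁) (hlt : k₁ < k₂) (hle : k₂ ≤ N)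
    (hne : f (c + N) ≠ f (c + k₁ + N)) : False := by
  apply hne
  have e₁ : f (c + N) = f (c + N - k₂) := h₂.eq
  have e₂ : f (c + k₁ + N - k₂) = f (c + N - k₂) := h₁.eq
  have e₃ : f (c + k₁ + N) = f (c + k₁ + N - k₂) := h₂.eq
  rw [e₁, e₃, e₂]

end Agree

/-- The number of occurrences of `c` in the window of `f` of length `p` starting at `i`. -/
def letterCount (f : ℤ → AB) (c : AB) (i : ℤ) (p : ℕ) : ℕ :=
  ∑ t ∈ Finset.range p, if f (i + t) = c then 1 else 0

lemma letterCount_succ (f : ℤ → AB) (c : AB) (i : ℤ) (p : ℕ) :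
    letterCount f c i (p + 1) = letterCount f c i p + if f (i + p) = c then 1 else 0 :=
  Finset.sum_range_succ _ _

lemma letterCount_succ' (f : ℤ → AB) (c : AB) (i : ℤ) (p : ℕ) :
    letterCount f c i (p + 1) = letterCount f c (i + 1) p + if f i = c then 1 else 0 := by
  unfold letterCount
  rw [Finset.sum_range_succ']
  simp [add_assoc, add_comm (1 : ℤ)]

lemma letterCount_congr {f : ℤ → AB} {i j : ℤ} {p : ℕ} (h : Agree f i j p) (c : AB) :
    letterCount f c i p = letterCount f c j p :=
  Finset.sum_congr rfl fun t ht => by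
    rw [h t (by omega) (by simpa using ht)]

lemma letterCount_slide (f : ℤ → AB) (c : AB) (i : ℤ) (p : ℕ) :
    letterCount f c i p + (if f (i + p) = c then 1 else 0) =
      letterCount f c (i + 1) p + if f i = c then 1 else 0 := by
  rw [← letterCount_succ, letterCount_succ']

lemma letterCount_add_eq {f : ℤ → AB} {c : AB} {i : ℤ} {p d : ℕ}
    (h : Agree f (i + p) i d) : letterCount f c (i + d) p = letterCount f c i p := by
  induction d with
  | zero => simp
  | succ d ih =>
    have h₁ := letterCount_slide f c (i + d) p
    have h₂ : f (i + d + p) = f (i + d) := h.eq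
    rw [h₂, ih (h.mono)] at h₁
    push_cast
    rw [← add_assoc]
    omega

/-- If all windows of length `p` that we consider lie in a `p`-periodic interval, they contain the
same number of `c`. -/
lemma letterCount_eq_of_period {f : ℤ → AB} {c : AB} {lo hi : ℤ} {p : ℕ}
    (h : Agree f (lo + p) lo (hi - lo - p)) {i j : ℤ} (hi₁ : lo ≤ i) (hi₂ : i + p ≤ hi)
    (hj₁ : lo ≤ j) (hj₂ : j + p ≤ hi) : letterCount f c i p = letterCount f c j p := by
  obtain ⟨d, rfl⟩ := Int.le.dest hi₁
  obtain ⟨e, rfl⟩ := Int.le.dest hj₁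
  rw [letterCount_add_eq h.mono, letterCount_add_eq h.mono]

/-- Two factors of `f` of the form `x u x` and `y u y` with `x ≠ y` and `|u| = n - 1`, starting at
`i` and `j`. -/
structure Unbal (f : ℤ → AB) (n i j : ℤ) : Prop where
  pos : 0 < n
  left : f i = f (i + n)
  right : f j = f (j + n)
  ne : f i ≠ f j
  mid : Agree f (i + 1) (j + 1) (n - 1)

lemma Unbal.symm {f : ℤ → AB} {n i j : ℤ} (h : Unbal f n i j) : Unbal f n j i :=
  ⟨h.pos, h.right, h.left, h.ne.symm, h.mid.symm⟩

lemma exists_unbal_of_letterCount {f : ℤ → AB} {c : AB} {i j : ℤ} {p : ℕ}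
    (h : letterCount f c j p + 2 ≤ letterCount f c i p) :
    ∃ t n : ℤ, 0 ≤ t ∧ t + n < p ∧ Unbal f n (i + t) (j + t) := by
  suffices H : letterCount f c i p ≤ letterCount f c j p ∨
      (letterCount f c i p = letterCount f c j p + 1 ∧ ∃ t : ℤ, 0 ≤ t ∧ t < p ∧ f (i + t) = c ∧
        f (j + t) ≠ c ∧ Agree f (i + t + 1) (j + t + 1) (p - t - 1)) ∨
      ∃ t n : ℤ, 0 ≤ t ∧ t + n < p ∧ Unbal f n (i + t) (j + t) by
    rcases H with H | H | H
    · omega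
    · omega
    · exact H
  clear h
  induction p with
  | zero => left; simp [letterCount]
  | succ p ih =>
    rw [letterCount_succ, letterCount_succ]
    rcases ih with h | ⟨h, t, ht₀, htp, hi, hj, hA⟩ | ⟨t, n, h₁, h₂, h₃⟩
    · by_cases h₁ : f (i + p) = c <;> by_cases h₂ : f (j + p) = c
      · left; simp [h₁, h₂, h]
      · simp only [h₁, h₂, if_true, if_false, add_zero]
        rcases h.lt_or_eq with h | h
        · left; omega
        · right; left
          refine ⟨by omega, p, by omega, by omega, h₁, h₂, fun t _ _ => ?_⟩
          push_cast at *
          omega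
      · left; simp [h₁, h₂]; omega
      · left; simp [h₁, h₂, h]
    · have ext : f (i + p) = f (j + p) →
          Agree f (i + t + 1) (j + t + 1) ((p + 1 : ℕ) - t - 1) := fun he =>
        (hA.succ he).mono
      by_cases h₁ : f (i + p) = c <;> by_cases h₂ : f (j + p) = c
      · right; left
        exact ⟨by simp [h₁, h₂, h], t, ht₀, by omega, hi, hj, ext (by rw [h₁, h₂])⟩
      · right; right
        have hd : f (j + t) = f (j + p) := by
          rcases AB.eq_or_eq h₂ (f (j + t)) with h₃ | h₃
          · exact h₃
          · exact absurd h₃ hj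
        refine ⟨t, p - t, ht₀, by omega, by omega, ?_, ?_, by rwa [hi, ne_comm], hA.mono⟩
        · rw [hi, ← h₁]; congr 1; omega
        · rw [hd]; congr 1; omega
      · left; simp [h₁, h₂]; omega
      · right; left
        refine ⟨by simp [h₁, h₂, h], t, ht₀, by omega, hi, hj, ext ?_⟩
        rcases AB.eq_or_eq h₂ (f (i + p)) with h₃ | h₃
        · exact h₃
        · exact absurd h₃ h₁
    · right; right
      exact ⟨t, n, h₁, by omega, h₃⟩

lemma Agree.comp_neg {f : ℤ → AB} {i j l : ℤ} (h : Agree f i j l) {i' j' l' : ℤ}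
    (hl : l' = l := by omega) (hi : i' = 1 - i - l := by omega)
    (hj : j' = 1 - j - l := by omega) : Agree (fun z => f (-z)) i' j' l' := fun t h₁ h₂ => h.eq

lemma Branch.suffix {f : ℤ → AB} {lo hi l i j : ℤ} (h : Branch f lo hi l i j) {l' i' j' : ℤ}
    (hl : l' ≤ l := by omega) (hi' : i' = i + (l - l') := by omega)
    (hj' : j' = j + (l - l') := by omega) : Branch f lo hi l' i' j' := by
  obtain ⟨h₁, h₂, h₃, h₄, h₅, h₆⟩ := h
  refine ⟨by omega, by omega, by omega, by omega, h₅.mono, ?_⟩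
  rwa [show i' + l' = i + l by omega, show j' + l' = j + l by omega]

lemma Branch.mono {f : ℤ → AB} {lo hi l i j : ℤ} (h : Branch f lo hi l i j) {lo' hi' : ℤ}
    (hlo : lo' ≤ lo := by omega) (hhi : hi ≤ hi' := by omega) : Branch f lo' hi' l i j :=
  ⟨by have := h.le_left; omega, by have := h.le_right; omega, by have := h.left_lt; omega,
    by have := h.right_lt; omega, h.agree, h.ne⟩

lemma Branch.symm {f : ℤ → AB} {lo hi l i j : ℤ} (h : Branch f lo hi l i j) :
    Branch f lo hi l j i :=
  ⟨h.le_right, h.le_left, h.right_lt, h.left_lt, h.agree.symm, h.ne.symm⟩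

lemma UniqueBranch.mono {f : ℤ → AB} {lo hi lo' hi' : ℤ} (h : UniqueBranch f lo hi)
    (hlo : lo ≤ lo' := by omega) (hhi : hi' ≤ hi := by omega) : UniqueBranch f lo' hi' :=
  fun _ _ _ _ _ hl h₁ h₂ => h hl h₁.mono h₂.mono

/-- The word `x u x y u y`, where `|u| = n - 1`, occurs in `f` around the boundary `m` between its
halves `x u x` and `y u y`, and `x u y` occurs in it at offset `k`. -/
structure Cross (f : ℤ → AB) (m n k : ℤ) : Prop where
  one_le : 1 ≤ k
  le : k ≤ n
  left : f (m - 1 - n) = f (m - 1)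
  right : f (m + n) = f m
  ne : f (m - 1) ≠ f m
  mid : Agree f (m - n) (m + 1) (n - 1)
  shift : Agree f (m - 1 - n + k) (m - 1 - n) n
  shift_end : f (m - 1 + k) = f m

/-- On `[lo, hi)` the function `f` spells `p x u x y u y q` where the two halves `p x u x` and
`y u y q` have periods `k` and `|u| + 2 - k`. -/
structure Shape (f : ℤ → AB) (m n k lo hi : ℤ) : Prop extends Cross f m n k where
  lo_le : lo ≤ m - 1 - n
  lt_hi : m + n < hi
  per_left : Agree f (lo + k) lo (m - lo - k)
  per_right : Agree f (m + (n + 1 - k)) m (hi - m - (n + 1 - k))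

section Shape

variable {f : ℤ → AB} {m n k lo hi : ℤ}

lemma Cross.shift_left (h : Cross f m n k) : Agree f m (m - k) (k - 1) := by
  obtain ⟨h₁, h₂, -, -, -, -, h₃, -⟩ := h
  exact h₃.mono

lemma Cross.toShape (h : Cross f m n k) : Shape f m n k (m - 1 - n) (m + n + 1) := by
  have hs := h.shift_left
  obtain ⟨h₁, h₂, -, h₃, -, h₄, h₅, h₆⟩ := id h
  refine ⟨h, le_rfl, by omega, h₅.mono, ?_⟩
  have h₇ : Agree f (m + (n + 1 - k)) (m - k) (k - 1) := h₄.symm.mono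
  have h₈ := (h₇.trans hs.symm).succ (p := m + n) (q := m - 1 + k) (by rw [h₃, h₆])
  exact h₈.mono

lemma Cross.comp_neg (h : Cross f m n k) : Cross (fun z => f (-z)) (1 - m) n (n + 1 - k) := by
  obtain ⟨h₁, h₂, h₃, h₄, h₅, h₆, h₇, h₈⟩ := h
  have e₁ : f (m - 1 - n + k) = f (m - 1 - n) := h₇.eq
  have h₉ : Agree f (m + k - n) (m + 1) n :=
    ((Agree.mono h₇ (i' := m + k - n) (j' := m - n) (l' := n - 1)).trans h₆).succ
      (p := m - 1 + k) (q := m + n) (by rw [h₈, h₄]) |>.mono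
  refine ⟨by omega, by omega, ?_, ?_, ?_, h₆.symm.comp_neg, h₉.comp_neg, ?_⟩
  · convert h₄ using 2 <;> omega
  · convert h₃ using 2 <;> omega
  · convert h₅.symm using 2
    · omega
    · omega
  · rw [h₃] at e₁
    convert e₁ using 2 <;> omega

namespace Shape

lemma comp_neg (h : Shape f m n k lo hi) :
    Shape (fun z => f (-z)) (1 - m) n (n + 1 - k) (1 - hi) (1 - lo) := by
  obtain ⟨h, h₁, h₂, h₃, h₄⟩ := h
  exact ⟨h.comp_neg, by omega, by omega, h₄.symm.comp_neg, h₃.symm.comp_neg⟩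

/-- The right half does not contain `x u`. -/
lemma not_agree_right (h : Shape f m n k lo hi) {i : ℤ} (h₁ : m ≤ i) (h₂ : i + n ≤ hi) :
    ¬ Agree f i (m - 1 - n) n := by
  intro hA
  obtain ⟨⟨h₃, h₄, h₅, h₆, h₇, h₈, h₉, -⟩, -, -, -, hp⟩ := h
  obtain ⟨p, hp'⟩ := Int.eq_ofNat_of_zero_le (show 0 ≤ n - k by omega)
  have e : f i = f (m - 1) := by rw [← h₅]; exact hA.eq
  have hA' : Agree f (i + 1) (m + 1) p :=
    (Agree.mono hA (i' := i + 1) (j' := m - n) (l' := p)).trans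
      (Agree.mono h₈ (i' := m - n) (j' := m + 1) (l' := p))
  have hc := letterCount_eq_of_period (c := f m) (lo := m) (hi := hi) (p := p + 1)
    (i := i) (j := m) hp.mono (by omega) (by push_cast; omega) le_rfl
      (by push_cast; omega)
  rw [letterCount_succ', letterCount_succ', letterCount_congr hA', e] at hc
  simp [h₇] at hc

/-- The left half does not contain `u y`. -/
lemma not_agree_left (h : Shape f m n k lo hi) {i : ℤ} (h₁ : lo ≤ i) (h₂ : i + n ≤ m) :
    ¬ Agree f i (m + 1) n := fun hA =>
  h.comp_neg.not_agree_right (i := 1 - i - n) (by omega) (by omega) hA.comp_neg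

lemma agree_prefix (h : Shape f m n k lo hi) : Agree f (lo + k) lo (m - 1 - lo) := by
  have hs := h.shift_left
  intro t h₁ h₂
  obtain ⟨⟨h₃, h₄, -⟩, -, -, hp, -⟩ := h
  by_cases ht : t < m - lo - k
  · exact hp.eq
  · exact hs.eq

lemma agree_suffix (h : Shape f m n k lo hi) :
    Agree f (m + 1 - (n + 1 - k)) (m + 1) (hi - m - 1) :=
  have := h.comp_neg.agree_prefix.comp_neg (i' := m + 1 - (n + 1 - k)) (j' := m + 1)
    (l' := hi - m - 1)
  by simpa using this

lemma branch (h : Shape f m n k lo hi) : Branch f lo hi (m - 1 - lo) lo (lo + k) := by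
  have hp := h.agree_prefix
  obtain ⟨⟨h₃, h₄, -, -, h₅, -, -, h₆⟩, h₇, h₈, -⟩ := h
  refine ⟨le_rfl, by omega, by omega, by omega, hp.symm, ?_⟩
  rw [show lo + (m - 1 - lo) = m - 1 by omega, show lo + k + (m - 1 - lo) = m - 1 + k by omega, h₆]
  exact h₅

lemma suffix_unrepeated (h : Shape f m n k lo hi) {i : ℤ} (h₁ : lo ≤ i) (h₂ : i < m) :
    ¬ Agree f i m (hi - m) := fun hA => by
  have := h.branch.length_add_le (i' := i) (k := hi - m)
    (by have := h.lo_le; have := h.le; have := h.one_le; omega)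
    (by have := h.lt_hi; have := h.le; have := h.one_le; omega) h₁ (by omega) hA.mono
  omega

lemma prefix_unrepeated (h : Shape f m n k lo hi) {i : ℤ} (h₁ : lo < i) (h₂ : i + (m - lo) ≤ hi) :
    ¬ Agree f i lo (m - lo) := fun hA => by
  refine h.comp_neg.suffix_unrepeated (i := 1 - i - (m - lo)) (by omega) (by omega) ?_
  exact Agree.comp_neg hA

lemma Rp_eq_and_Kp_eq {N : ℕ} (h : Shape f m n k lo (lo + N)) :
    (Rp (window f lo N) : ℤ) = m - lo ∧ (Kp (window f lo N) : ℤ) = lo + N - m := by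
  have hb := h.branch
  have hs := h.agree_suffix
  obtain ⟨⟨h₁, h₂, -⟩, h₃, h₄, -⟩ := h
  obtain ⟨r, hr⟩ := Int.eq_ofNat_of_zero_le (show 0 ≤ m - 1 - lo by omega)
  obtain ⟨s, hs'⟩ := Int.eq_ofNat_of_zero_le (show 0 ≤ lo + N - m - 1 by omega)
  rw [hr] at hb
  have hR := hb.lt_Rp
  have hK := lt_Kp_of_agree (f := f) (lo := lo) (n := N) (k := s) (i := m + 1 - (n + 1 - k))
    (by omega) (by omega) hs.mono
  have := Rp_add_Kp_le (window f lo N)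
  rw [length_window] at this
  omega

lemma extend_right (h : Shape f m n k lo hi) (hu : UniqueBranch f lo (hi + 1)) :
    Shape f m n k lo (hi + 1) := by
  have hb := h.branch
  have hs := h.agree_suffix
  have hx := h.not_agree_right (i := hi - n)
  obtain ⟨hc, h₃, h₄, h₅, h₆⟩ := h
  obtain ⟨h₁, h₂, -⟩ := id hc
  refine ⟨hc, h₃, by omega, h₅, ?_⟩
  suffices e : f hi = f (hi - (n + 1 - k)) from (h₆.succ e).mono
  by_contra e
  refine hx (by omega) (by omega) ?_
  have hb₁ : Branch f lo (hi + 1) (hi - m - 1) (m + 1) (m + 1 - (n + 1 - k)) := by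
    refine ⟨by omega, by omega, by omega, by omega, hs.symm, ?_⟩
    rwa [show m + 1 + (hi - m - 1) = hi by omega,
      show m + 1 - (n + 1 - k) + (hi - m - 1) = hi - (n + 1 - k) by omega]
  have hb₂ : Branch f lo (hi + 1) (m - 1 - lo) lo (lo + k) := hb.mono
  exact hu (l := n) (by omega) (hb₁.suffix (l' := n) (j' := hi - n - (n + 1 - k)))
    (hb₂.suffix (l' := n) (j' := m - 1 - n + k))

lemma extend_left (h : Shape f m n k lo hi) (hu : UniqueBranch f (lo - 1) hi) :
    Shape f m n k (lo - 1) hi := by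
  have hb := h.branch
  obtain ⟨hc, h₃, h₄, h₅, h₆⟩ := id h
  obtain ⟨h₁, h₂, h₇, -, h₈, -, -, h₉⟩ := id hc
  refine ⟨hc, by omega, h₄, ?_, h₆⟩
  suffices e : f (lo - 1 + k) = f (lo - 1) by
    have h₁₀ : Agree f (lo - 1 + k + 1) (lo - 1 + 1) (m - lo - k) := h₅.mono
    exact (h₁₀.cons e).mono
  by_contra e
  have hun : ∀ i, lo - 1 ≤ i → i + (hi - m) < hi → ¬ Agree f i (hi - (hi - m)) (hi - m) := by
    intro i hi₁ hi₂ hA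
    rcases eq_or_lt_of_le hi₁ with rfl | hi₃
    · exact h.not_agree_left (i := lo) le_rfl (by omega) hA.mono
    · exact h.suffix_unrepeated (i := i) (by omega) (by omega) hA.mono
  have key : ∀ i j, Branch f (lo - 1) hi (m - lo) i j → f (i + (m - lo)) = f (m - 1) → False := by
    intro i j hij hfi
    obtain ⟨g₁, g₂, g₃, g₄, g₅, g₆⟩ := id hij
    have hA : Agree f (i + 1) lo (m - 1 - lo) :=
      hu (by omega) (hij.suffix (j' := j + 1)) hb.mono
    have hA₂ : Agree f (j + 1) lo (m - 1 - lo) :=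
      (g₅.symm.mono (i' := j + 1) (j' := i + 1)).trans hA
    have hi₀ : i = lo - 1 := by
      by_contra hne
      refine h.prefix_unrepeated (i := i + 1) (by omega) (by omega) ?_
      exact (hA.succ (p := i + (m - lo)) (q := m - 1) hfi).mono
    subst hi₀
    have hj : j ≠ lo - 1 := by
      rintro rfl
      exact g₆ rfl
    have hfj : f j = f (lo - 1) := g₅.symm.eq
    have hjn : j + 1 - lo ≤ n := by
      by_contra hlt
      exact h.not_agree_right (i := j + 1 + (m - 1 - lo) - n) (by omega) (by omega) hA₂.mono
    have hne : f (j + (m - lo)) ≠ f (m - 1) := by rwa [ne_comm, ← hfi]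
    rcases lt_trichotomy (j + 1 - lo) k with hlt | heq | hgt
    · refine Agree.false_of_two_shifts (c := lo) (k₁ := j + 1 - lo) (k₂ := k) (N := m - 1 - lo)
        hA₂.mono hb.agree.symm (by omega) hlt (by omega) ?_
      rw [show lo + (m - 1 - lo) = m - 1 by omega,
        show lo + (j + 1 - lo) + (m - 1 - lo) = j + (m - lo) by omega]
      exact hne.symm
    · rw [← heq, show lo - 1 + (j + 1 - lo) = j by omega] at e
      exact e hfj
    · refine Agree.false_of_two_shifts (c := lo) (k₁ := k) (k₂ := j + 1 - lo) (N := m - 1 - lo)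
        hb.agree.symm hA₂.mono (by omega) hgt (by omega) ?_
      rw [show lo + (m - 1 - lo) = m - 1 by omega,
        show lo + k + (m - 1 - lo) = m - 1 + k by omega, h₉]
      exact h₈
  obtain ⟨i, j, hij⟩ := hu.exists_branch (k := hi - m) (by omega) (by omega) hun
  rw [show hi - (lo - 1) - (hi - m) - 1 = m - lo by omega] at hij
  by_cases hfi : f (i + (m - lo)) = f (m - 1)
  · exact key i j hij hfi
  · refine key j i hij.symm ?_
    rcases AB.eq_or_eq (Ne.symm hfi) (f (j + (m - lo))) with h' | h'
    · exact h'
    · exact absurd h'.symm hij.ne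

end Shape

end Shape

section AgreeGlue

variable {f : ℤ → AB} {i j l : ℤ}

lemma Agree.comp (h : Agree f i j l) {p q l' : ℤ} (h' : Agree f p q l') {r s k : ℤ}
    (h₁ : i ≤ r := by omega) (h₂ : r + k ≤ i + l := by omega)
    (h₃ : p ≤ j + (r - i) := by omega) (h₄ : j + (r - i) + k ≤ p + l' := by omega)
    (h₅ : s = q + (j + (r - i) - p) := by omega) : Agree f r s k :=
  fun t _ _ => (h.eq (q := j + (r + t - i))).trans h'.eq

lemma Agree.snoc (h : Agree f i j l) {p q : ℤ} (he : f p = f q) {r s k : ℤ}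
    (hp : p = i + l := by omega) (hq : q = j + l := by omega) (h₁ : i ≤ r := by omega)
    (h₂ : r + k ≤ i + l + 1 := by omega) (h₃ : s = j + (r - i) := by omega) : Agree f r s k :=
  (h.succ he).mono

lemma Agree.cons' (h : Agree f i j l) {p q : ℤ} (he : f p = f q) {k : ℤ}
    (hp : i = p + 1 := by omega) (hq : j = q + 1 := by omega) (h₁ : k ≤ l + 1 := by omega) :
    Agree f p q k := by
  subst hp hq
  exact (Agree.cons h he).mono

end AgreeGlue

/-- The interval `[lo, hi)` of `f` contains two factors `x u x` and `y u y` with `x ≠ y` and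
`|u| = n - 1`. -/
def UnbalAt (f : ℤ → AB) (lo hi n : ℤ) : Prop :=
  ∃ i j, lo ≤ i ∧ i + n < hi ∧ lo ≤ j ∧ j + n < hi ∧ Unbal f n i j

section MinimalUnbalanced

variable {f : ℤ → AB} {lo hi n : ℤ}

/-- A minimal unbalanced interval `x u x ⋯ y u y` in which `x u y` occurs is `x u x y u y`. -/
lemma exists_cross_of_agree (hu : UniqueBranch f lo hi) (h : Unbal f n lo (hi - 1 - n))
    (hlt : lo < hi - 1 - n) (hL : ¬ UnbalAt f (lo + 1) hi n) (hR : ¬ UnbalAt f lo (hi - 1) n)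
    {i : ℤ} (hi₁ : lo ≤ i) (hi₂ : i + n < hi) (hA : Agree f i lo n)
    (hy : f (i + n) = f (hi - 1 - n)) :
    hi = lo + 2 * n + 2 ∧ Cross f (lo + n + 1) n (i - lo) := by
  obtain ⟨h₀, hx, hy', hne, hm⟩ := h
  have hfi : f i = f lo := hA.eq
  have hi₃ : i ≠ lo := by
    rintro rfl
    rw [← hx] at hy
    exact hne hy
  have hi₄ : i ≠ hi - 1 - n := by
    rintro rfl
    exact hne hfi.symm
  have hb : Branch f lo hi n lo i :=
    ⟨le_rfl, hi₁, by omega, hi₂, hA.symm, by rwa [← hx, hy]⟩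
  have hmid : Agree f (i + 1) (hi - n) (n - 1) :=
    hA.comp hm
  have hend : f (i + n) = f (hi - 1) := by
    rw [hy, hy', sub_add_cancel]
  have hlen := hb.length_add_le (k := n) (i' := i + 1) (by omega) (by omega) (by omega) (by omega)
    (hmid.snoc hend)
  have hhi : hi = lo + 2 * n + 2 := by
    by_contra hhi
    obtain ⟨p, q, hpq⟩ := hu.exists_branch (k := n + 1) (by omega) (by omega) fun j hj₁ hj₂ hj => by
      have e₁ : f j = f (hi - 1 - n) := hj.eq
      have e₂ : f (j + n) = f (hi - 1) := hj.eq
      refine hR ⟨lo, j, le_rfl, by omega, hj₁, by omega, h₀, hx, ?_, by rwa [e₁], ?_⟩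
      · rw [e₁, e₂, hy', sub_add_cancel]
      · exact hm.comp (Agree.symm hj)
    have key : ∀ p q, Branch f lo hi (hi - lo - (n + 1) - 1) p q →
        f (p + (hi - lo - (n + 1) - 1)) ≠ f lo := by
      intro p q hpq e
      have hA' := hu (by omega) (hpq.suffix (l' := n) (i' := p + (hi - lo - (n + 1) - 1) - n)
        (j' := q + (hi - lo - (n + 1) - 1) - n)) hb
      have h₁ := hpq.le_left
      have h₂ := hpq.left_lt
      refine hL ⟨p + (hi - lo - (n + 1) - 1) - n, hi - 1 - n, by omega, by omega, by omega,
        by omega, h₀, ?_, hy', ?_, ?_⟩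
      · rw [sub_add_cancel, e]
        exact hA'.eq
      · rwa [show f (p + (hi - lo - (n + 1) - 1) - n) = f lo from hA'.eq]
      · exact hA'.comp hm
    have k₁ := key p q hpq
    rcases AB.eq_or_eq k₁ (f (q + (hi - lo - (n + 1) - 1))) with e | e
    · exact hpq.ne e.symm
    · exact key q p hpq.symm e
  subst hhi
  refine ⟨rfl, by omega, by omega, ?_, ?_, ?_, hm.mono, ?_, ?_⟩
  · convert hx using 2 <;> omega
  · convert hy'.symm using 2 <;> omega
  · rw [show lo + n + 1 - 1 = lo + n by omega, ← hx]
    convert hne using 2; omega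
  · exact hA.mono
  · convert hy using 2 <;> omega

/-- In an unbalanced interval `x u x ⋯ y u y` that is minimal, also with respect to `|u|`, the word
`x u y` occurs. -/
lemma exists_agree_of_minimal (hu : UniqueBranch f lo hi) (h : Unbal f n lo (hi - 1 - n))
    (hlt : lo < hi - 1 - n) (hL : ¬ UnbalAt f (lo + 1) hi n) (hR : ¬ UnbalAt f lo (hi - 1) n)
    (hmin : ∀ n', UnbalAt f lo hi n' → n ≤ n') :
    ∃ i, lo ≤ i ∧ i + n < hi ∧ Agree f i lo n ∧ f (i + n) = f (hi - 1 - n) := by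
  by_contra! hno
  obtain ⟨h₀, hx, hy, hne, hm⟩ := h
  rw [sub_add_cancel] at hy
  have hxu : ∀ i, lo < i → i + n < hi → ¬ Agree f i lo n := by
    intro i hi₁ hi₂ hA
    have e₁ : f i = f lo := hA.eq
    have e₂ : f (i + n) = f lo := by
      rcases AB.eq_or_eq hne (f (i + n)) with e | e
      · exact e
      · exact absurd e (hno i hi₁.le hi₂ hA)
    refine hL ⟨i, hi - 1 - n, by omega, by omega, by omega, by omega, h₀, by rw [e₁, e₂], ?_,
      by rwa [e₁], Agree.comp hA hm⟩
    rw [sub_add_cancel, hy]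
  have huy : ∀ i, lo ≤ i → i + n < hi → ¬ Agree f i (hi - n) n := by
    intro i hi₁ hi₂ hA
    have e₂ : f (i + n - 1) = f (hi - 1) := hA.eq
    have hA' : Agree f (lo + 1) i (n - 1) := hm.comp (Agree.symm hA)
    rcases eq_or_lt_of_le hi₁ with rfl | hi₃
    · have := hA'.symm.eq_of_overlap (by omega)
      rw [show lo + (n - 1) = lo + n - 1 by omega, e₂, ← hy] at this
      exact hne this
    · rcases AB.eq_or_eq hne (f (i - 1)) with e | e
      · refine hno (i - 1) (by omega) (by omega) ?_ ?_
        · exact hA'.symm.cons' e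
        · rw [show i - 1 + n = i + n - 1 by omega, e₂, hy]
      · refine hR ⟨lo, i - 1, le_rfl, by omega, by omega, by omega, h₀, hx, ?_, by rwa [e],
          hA'.mono⟩
        rw [e, show i - 1 + n = i + n - 1 by omega, e₂, hy]
  obtain ⟨e, ⟨he₁, he₂, heu⟩, hemin⟩ := Int.exists_least_of_bdd
    (P := fun e => 1 ≤ e ∧ lo + 1 + e ≤ hi - n ∧ Agree f (lo + 1 + e) (lo + 1) (n - 1))
    ⟨1, fun z hz => hz.1⟩ ⟨hi - n - (lo + 1), by omega, by omega, hm.symm.mono⟩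
  have hb : Branch f lo hi (n - 1) (lo + 1) (hi - n) := by
    refine ⟨by omega, by omega, by omega, by omega, hm.mono, ?_⟩
    rw [show lo + 1 + (n - 1) = lo + n by omega, show hi - n + (n - 1) = hi - 1 by omega, ← hx,
      ← hy]
    exact hne
  have hper : ∀ t : ℕ, lo + 1 + e + (n - 1) + t ≤ hi - 1 →
      Agree f (lo + 1 + e) (lo + 1) (n - 1 + t) := by
    intro t
    induction t with
    | zero => intro _; exact heu.mono
    | succ t ih =>
      intro ht
      push_cast at ht
      have hA := ih (by omega)
      suffices hs : f (lo + 1 + e + (n - 1 + t)) = f (lo + 1 + (n - 1 + t)) from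
        hA.snoc hs
      by_contra hs
      have hb' : Branch f lo hi (n - 1 + t) (lo + 1 + e) (lo + 1) :=
        ⟨by omega, by omega, by omega, by omega, hA, hs⟩
      have key : ∀ p q, p + (n - 1 + t) < hi - 1 → Branch f lo hi (n - 1 + t) p q →
          f (p + (n - 1 + t)) ≠ f (hi - 1) := by
        intro p q hlt hpq he
        have h₁ := hpq.le_left
        have h₂ := hu (by omega) (hpq.suffix (l' := n - 1) (i' := p + t) (j' := q + t)) hb
        have h₃ : Agree f (p + t) (hi - n) (n - 1) := h₂.comp hm
        exact huy (p + t) (by omega) (by omega)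
          (h₃.snoc he)
      have k₁ := key _ _ (by omega) hb'
      rcases AB.eq_or_eq k₁ (f (lo + 1 + (n - 1 + t))) with e₁ | e₁
      · exact hs e₁.symm
      · exact key _ _ (by omega) hb'.symm e₁
  have hper : Agree f (lo + 1 + e) (lo + 1) (hi - 2 - lo - e) :=
    (hper (hi - 1 - (lo + 1 + e + (n - 1))).toNat (by omega)).mono
  have hfe : f (lo + e) = f (hi - 1) := by
    rcases AB.eq_or_eq hne (f (lo + e)) with e₁ | e₁
    · refine absurd ?_ (hxu (lo + e) (by omega) (by omega))
      exact heu.cons' e₁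
    · rw [e₁, hy]
  have hfx : f (hi - 1 - e) = f lo := by
    rcases AB.eq_or_eq hne (f (hi - 1 - e)) with e₁ | e₁
    · exact e₁
    · refine absurd ?_ (huy (hi - n - e) (by omega) (by omega))
      exact hper.symm.snoc (p := hi - 1 - e) (q := hi - 1) (by rw [e₁, hy])
  have hne' : f lo ≠ f (hi - 1) := by rwa [← hy]
  have hb' : Branch f lo hi (hi - 2 - lo - e) (lo + 1) (lo + 1 + e) := by
    refine ⟨by omega, by omega, by omega, by omega, hper.symm, ?_⟩
    rwa [show lo + 1 + (hi - 2 - lo - e) = hi - 1 - e by omega,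
      show lo + 1 + e + (hi - 2 - lo - e) = hi - 1 by omega, hfx]
  have hnob : ∀ i j, Branch f lo hi (hi - 1 - lo - e) i j →
      f (i + (hi - 1 - lo - e)) ≠ f (hi - 1) := by
    intro i j hij hfi
    obtain ⟨g₁, g₂, g₃, g₄, g₅, g₆⟩ := id hij
    have hA : Agree f (i + 1) (lo + 1) (hi - 2 - lo - e) :=
      hu (by omega) (hij.suffix (l' := hi - 2 - lo - e) (j' := j + 1)) hb'
    have hi₀ : i = lo + e := by
      by_contra hi₀
      have h₁ := hA.trans hper.symm
      exact huy (i + (hi - 1 - lo - e) - n + 1) (by omega) (by omega) (h₁.snoc hfi)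
    subst hi₀
    have hfj : f j = f (lo + e) := g₅.symm.eq
    have hj₀ : j ≠ lo := by
      rintro rfl
      rw [hfe] at hfj
      exact hne' hfj
    have hj₁ : j ≠ lo + e := by
      rintro rfl
      exact g₆ rfl
    have h₂ : Agree f (j + 1) (lo + 1) (n - 1) :=
      g₅.symm.comp hA
    have := hemin (j - lo) ⟨by omega, by omega, h₂.mono⟩
    omega
  have hen : e < n := by
    by_contra hen
    obtain ⟨i, j, hij⟩ := hu.exists_branch (k := n) (by omega) (by omega) huy
    have hij' := hij.suffix (l' := hi - 1 - lo - e) (i' := i + (e - n)) (j' := j + (e - n))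
    have k₁ := hnob _ _ hij'
    rcases AB.eq_or_eq k₁ (f (j + (e - n) + (hi - 1 - lo - e))) with e₁ | e₁
    · exact hij'.ne e₁.symm
    · exact hnob _ _ hij'.symm e₁
  obtain ⟨d, rfl⟩ := Int.eq_ofNat_of_zero_le (show 0 ≤ e by omega)
  have c₁ := letterCount_slide f (f lo) lo d
  have c₂ := letterCount_slide f (f lo) (hi - 1 - d) d
  rw [if_pos rfl, hfe, if_neg hne'.symm] at c₁
  rw [sub_add_cancel, if_neg hne'.symm, hfx, if_pos rfl] at c₂
  have c₃ := letterCount_eq_of_period (c := f lo) (lo := lo + 1) (hi := hi - 1) (p := d)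
    (i := lo + 1) (j := hi - 1 - d) hper.mono (by omega) (by omega) (by omega) (by omega)
  obtain ⟨t, n', ht, htn, hun⟩ := exists_unbal_of_letterCount (f := f) (c := f lo) (i := lo)
    (j := hi - 1 - d + 1) (p := d) (by omega)
  have hp := hun.pos
  have := hmin n' ⟨_, _, by omega, by omega, by omega, by omega, hun⟩
  omega

end MinimalUnbalanced

lemma UniqueBranch.exists_shape {f : ℤ → AB} {lo hi : ℤ} (hu : UniqueBranch f lo hi)
    (h : ∃ n, UnbalAt f lo hi n) : ∃ m n k, Shape f m n k lo hi := by
  obtain ⟨N, hN⟩ : ∃ N : ℕ, (hi - lo).toNat = N := ⟨_, rfl⟩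
  induction N generalizing lo hi with
  | zero =>
    obtain ⟨n, i, j, h₁, h₂, -, -, h₃⟩ := h
    have := h₃.pos
    omega
  | succ N ih =>
    by_cases hR : ∃ n, UnbalAt f lo (hi - 1) n
    · obtain ⟨m, n, k, hs⟩ := ih (hu.mono) hR (by omega)
      have := hs.extend_right (by rwa [sub_add_cancel])
      rw [sub_add_cancel] at this
      exact ⟨m, n, k, this⟩
    by_cases hL : ∃ n, UnbalAt f (lo + 1) hi n
    · obtain ⟨m, n, k, hs⟩ := ih (hu.mono) hL (by omega)
      have := hs.extend_left (by rwa [add_sub_cancel_right])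
      rw [add_sub_cancel_right] at this
      exact ⟨m, n, k, this⟩
    obtain ⟨n, hn, hmin⟩ := Int.exists_least_of_bdd (P := UnbalAt f lo hi)
      ⟨1, fun n ⟨_, _, _, _, _, _, h⟩ => h.pos⟩ h
    have hR' : ¬ UnbalAt f lo (hi - 1) n := fun h => hR ⟨n, h⟩
    have hL' : ¬ UnbalAt f (lo + 1) hi n := fun h => hL ⟨n, h⟩
    obtain ⟨hlt, hun⟩ : lo < hi - 1 - n ∧ Unbal f n lo (hi - 1 - n) := by
      obtain ⟨i, j, h₁, h₂, h₃, h₄, hij⟩ := hn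
      have hne : i ≠ j := by
        rintro rfl
        exact hij.ne rfl
      have o₁ : i = lo ∨ j = lo := by
        by_contra! hc
        exact hL' ⟨i, j, by omega, h₂, by omega, h₄, hij⟩
      have o₂ : i = hi - 1 - n ∨ j = hi - 1 - n := by
        by_contra! hc
        exact hR' ⟨i, j, h₁, by omega, h₃, by omega, hij⟩
      rcases o₁ with rfl | rfl
      · obtain rfl : j = hi - 1 - n := by omega
        exact ⟨by omega, hij⟩
      · obtain rfl : i = hi - 1 - n := by omega
        exact ⟨by omega, hij.symm⟩
    obtain ⟨i, h₁, h₂, h₃, h₄⟩ := exists_agree_of_minimal hu hun hlt hL' hR' hmin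
    obtain ⟨rfl, hc⟩ := exists_cross_of_agree hu hun hlt hL' hR' h₁ h₂ h₃ h₄
    refine ⟨lo + n + 1, n, i - lo, ?_⟩
    convert hc.toShape using 1 <;> omega

section MinPeriod

variable {f : ℤ → AB} {i : ℤ} {n : ℕ}

lemma getElem?_window {t : ℕ} (h : t < n) : (window f i n)[t]? = some (f (i + t)) := by
  rw [List.getElem?_eq_getElem (by simpa using h), getElem_window]

lemma hasPeriod_window_iff {p : ℕ} :
    (window f i n).HasPeriod p ↔ Agree f (i + p) i (n - p) := by
  rw [List.hasPeriod_iff_getElem?, length_window]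
  constructor
  · intro h t h₁ h₂
    lift t to ℕ using h₁
    have := h t (by omega)
    rw [getElem?_window (by omega), getElem?_window (by omega), Option.some_inj] at this
    rw [this]
    congr 1
    push_cast
    ring
  · intro h t ht
    rw [getElem?_window (by omega), getElem?_window (by omega), Option.some_inj]
    exact h.symm.eq

lemma exists_border_window_iff {s : ℕ} :
    (∃ v : Word, v.length = s ∧ v <+: window f i n ∧ v ≠ window f i n ∧ v <:+ window f i n) ↔
      s < n ∧ Agree f (i + (n - s)) i s := by
  constructor
  · rintro ⟨v, rfl, ⟨t, ht⟩, hne, ⟨t', ht'⟩⟩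
    have h₁ := congrArg List.length ht
    have h₁' := congrArg List.length ht'
    simp only [List.length_append, length_window] at h₁ h₁'
    have h₂ := (append_eq_window ht).1
    have h₃ := (append_eq_window ht').2
    refine ⟨?_, ?_⟩
    · rcases Nat.eq_zero_or_pos t.length with h₀ | h₀
      · rw [List.length_eq_zero_iff] at h₀
        simp [h₀] at ht
        exact absurd ht hne
      · omega
    · have := window_eq_iff.1 (h₃.symm.trans h₂)
      convert this using 2
      omega
  · rintro ⟨h₁, h₂⟩
    obtain ⟨d, rfl⟩ := Nat.exists_eq_add_of_le h₁.le
    refine ⟨window f i s, by simp, ?_, ?_, ?_⟩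
    · rw [window_add]
      exact List.prefix_append _ _
    · intro h
      have := congrArg List.length h
      simp at this
      omega
    · rw [add_comm s d, window_add]
      refine ⟨window f i d, ?_⟩
      congr 1
      refine window_eq_iff.2 ?_
      exact h₂.symm.mono

lemma minPeriod_window_eq_iff (hn : 0 < n) {k : ℕ} :
    minPeriod (window f i n) = k ↔ 0 < k ∧ k ≤ n ∧ Agree f (i + k) i (n - k) ∧
      ∀ d : ℕ, 0 < d → d < k → ¬ Agree f (i + d) i (n - d) := by
  simp only [minPeriod, exists_border_window_iff, length_window]
  set B : Set ℕ := {s | s < n ∧ Agree f (i + (n - s)) i s} with hB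
  have hbdd : BddAbove B := ⟨n, fun s hs => hs.1.le⟩
  have hmem : sSup B ∈ B := Nat.sSup_mem ⟨0, hn, fun t _ _ => by push_cast at *; omega⟩ hbdd
  have hle : ∀ d : ℕ, 0 < d → d ≤ n → Agree f (i + d) i (n - d) → n - d ≤ sSup B :=
    fun d h₁ h₂ h₃ => le_csSup hbdd ⟨by omega, h₃.mono⟩
  obtain ⟨h₁, h₂⟩ := hmem
  constructor
  · rintro rfl
    refine ⟨by omega, by omega, h₂.mono, fun d h₃ h₄ h₅ => ?_⟩
    have := hle d h₃ (by omega) h₅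
    omega
  · rintro ⟨h₃, h₄, h₅, h₆⟩
    have h₇ := hle k h₃ h₄ h₅
    by_contra hne
    refine h₆ (n - sSup B) (by omega) (by omega) ?_
    exact h₂.mono

end MinPeriod

namespace Cross

variable {f : ℤ → AB} {m n k d : ℤ}

lemma not_agree_of_lt_left (h : Cross f m n k) (hd₀ : 0 < d) (hd : d < k) :
    ¬ Agree f (m - n + d) (m - n) (n - d) := by
  intro hA
  have hp := h.toShape.per_right
  obtain ⟨h₁, h₂, h₃, h₄, h₅, h₆, h₇, h₈⟩ := h
  have hx : f (m - 1) = f (m - 1 - d) := hA.eq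
  have hy : f (m + n) = f (k - 1 + m) := hp.eq
  have hz : f (k - 1 + m) = f (m - n + (k - 2)) := h₆.symm.eq
  lift d to ℕ using hd₀.le
  obtain ⟨N, hN⟩ := Int.eq_ofNat_of_zero_le (show 0 ≤ n - 1 by omega)
  obtain ⟨r, hr⟩ := Int.eq_ofNat_of_zero_le (show 0 ≤ n + 1 - k by omega)
  rw [hr] at hp
  have p₁ : (window f (m - n) N).HasPeriod d := hasPeriod_window_iff.2 hA.mono
  have p₂ : (window f (m - n) N).HasPeriod r := by
    rw [window_eq_iff.2 (h₆.mono : Agree f (m - n) (m + 1) N)]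
    exact hasPeriod_window_iff.2 hp.mono
  have hg := Nat.gcd_pos_of_pos_left r (m := d) (by omega)
  have p₃ := List.hasPeriod_iff_forall_getElem?_mod.1
    (p₁.gcd p₂ (by rw [length_window]; omega))
  rw [length_window] at p₃
  have q₁ := p₃ (N - d) (by omega)
  have q₂ := p₃ (N - r) (by omega)
  have hmod : ∀ c, d.gcd r ∣ c → c ≤ N → (N - c) % d.gcd r = N % d.gcd r := by
    rintro _ ⟨e, rfl⟩ he
    exact Nat.sub_mul_mod he
  rw [hmod d (Nat.gcd_dvd_left _ _) (by omega), ← hmod r (Nat.gcd_dvd_right _ _) (by omega), ← q₂,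
    getElem?_window (by omega), getElem?_window (by omega), Option.some_inj] at q₁
  apply h₅
  rw [hx, ← h₄, hy, hz]
  convert q₁ using 2 <;> omega

lemma not_agree_of_lt_right (h : Cross f m n k) (hd₀ : 0 < d) (hd : d < n + 1 - k) :
    ¬ Agree f (m + d) m (n - d) := fun hA =>
  h.comp_neg.not_agree_of_lt_left hd₀ hd hA.symm.comp_neg

end Cross

lemma isCentral_iff_of_ne {u : Word} {x y : AB} (h : x ≠ y) :
    IsCentral u ↔ (∃ n, u = List.replicate n x) ∨ (∃ n, u = List.replicate n y) ∨
      ∃ s t, u = s ++ [x, y] ++ t ∧ u = t ++ [y, x] ++ s := by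
  unfold IsCentral
  cases x <;> cases y
  · exact absurd rfl h
  · rfl
  · rw [or_left_comm]
    refine or_congr_right (or_congr_right ?_)
    exact ⟨fun ⟨s, t, h₁, h₂⟩ => ⟨t, s, h₂, h₁⟩, fun ⟨s, t, h₁, h₂⟩ => ⟨t, s, h₂, h₁⟩⟩
  · exact absurd rfl h

section Central

variable {f : ℤ → AB} {m n k i : ℤ} {N : ℕ}

lemma Agree.window_eq_replicate (h : Agree f (i + 1) i N) (p : ℕ) (hp : p ≤ N + 1) :
    window f i p = List.replicate p (f i) := by
  induction p with
  | zero => rfl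
  | succ p ih =>
    rw [window_add, ih (by omega), window_one, List.replicate_succ']
    have : Agree f i (i + 1) p := h.symm.mono
    rw [this.eq_of_overlap (by omega)]

lemma append_pair_append_eq_window {s t : Word} {c d : AB} (h : s ++ [c, d] ++ t = window f i N) :
    s = window f i s.length ∧ f (i + s.length) = c ∧ f (i + s.length + 1) = d ∧
      t = window f (i + s.length + 2) t.length ∧ s.length + t.length + 2 = N := by
  have hN := congrArg List.length h
  simp only [List.length_append, length_window, List.length_cons, List.length_nil] at hN
  obtain ⟨h₁, h₂⟩ := append_eq_window h
  obtain ⟨h₃, h₄⟩ := append_eq_window h₁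
  simp only [List.length_cons, List.length_nil, window, List.cons.injEq, and_true] at h₄
  refine ⟨h₃, h₄.1.symm, h₄.2.symm, ?_, by omega⟩
  convert h₂ using 2
  simp
  ring

lemma window_eq_append_pair_append {s t : ℕ} :
    window f i (s + t + 2) =
      window f i s ++ [f (i + s), f (i + s + 1)] ++ window f (i + s + 2) t := by
  rw [show s + t + 2 = s + 2 + t by ring, window_add, window_add]
  simp [window, add_assoc]

lemma Cross.isCentral (h : Cross f m (N + 1) k) : IsCentral (window f (m - (N + 1)) N) := by
  have hs := h.toShape
  have hl := hs.per_left
  have hr := hs.per_right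
  obtain ⟨h₁, h₂, h₃, h₄, h₅, h₆, h₇, h₈⟩ := h
  rw [isCentral_iff_of_ne h₅]
  rcases h₂.eq_or_lt with rfl | h₂
  · refine Or.inr (Or.inl ⟨N, ?_⟩)
    have hr' : Agree f (m + 1) m (N + 1 : ℕ) := hr.mono
    rw [window_eq_iff.2 (h₆.mono : Agree f (m - (N + 1)) (m + 1) N)]
    exact (List.cons.inj (hr'.window_eq_replicate (N + 1) (by omega))).2
  rcases h₁.eq_or_lt with rfl | h₁
  · refine Or.inl ⟨N, ?_⟩
    have hl' : Agree f (m - 1 - (N + 1) + 1) (m - 1 - (N + 1)) (N + 1 : ℕ) := hl.mono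
    have := (List.cons.inj (hl'.window_eq_replicate (N + 1) (by omega))).2
    rwa [h₃, show m - 1 - (N + 1 : ℤ) + 1 = m - (N + 1) by ring] at this
  obtain ⟨t, ht⟩ := Int.eq_ofNat_of_zero_le (show 0 ≤ k - 2 by omega)
  obtain ⟨s, hs⟩ := Int.eq_ofNat_of_zero_le (show 0 ≤ N - k by omega)
  obtain rfl : N = s + t + 2 := by omega
  obtain rfl : k = t + 2 := by omega
  refine Or.inr (Or.inr ⟨window f (m - 1 - s) s, window f (m + 1) t, ?_, ?_⟩)
  · have : Agree f (m - ((s + t + 2 : ℕ) + 1)) (m - 1 - s) (s + t + 2 : ℕ) := h₇.symm.mono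
    rw [window_eq_iff.2 this, window_eq_append_pair_append,
      show m - 1 - (s : ℤ) + s + 2 = m + 1 by ring, show m - 1 - (s : ℤ) + s + 1 = m by ring,
      sub_add_cancel]
  · have e₁ : window f (m - ((s + t + 2 : ℕ) + 1)) t = window f (m + 1) t :=
      window_eq_iff.2 h₆.mono
    have e₂ : f (m - ((s + t + 2 : ℕ) + 1) + t) = f m := by
      rw [← h₈]
      exact h₆.eq
    have e₃ : f (m - ((s + t + 2 : ℕ) + 1) + t + 1) = f (m - 1) := by
      rw [← h₃]
      exact h₇.eq
    have e₄ : m - ((s + t + 2 : ℕ) + 1) + t + 2 = m - 1 - s := by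
      push_cast
      ring
    rw [← e₁, ← e₂, ← e₃, ← e₄, ← window_eq_append_pair_append, add_comm s t]

lemma exists_cross_of_isCentral (hc : IsCentral (window f (m - (N + 1)) N))
    (left : f (m - 1 - (N + 1)) = f (m - 1)) (right : f (m + (N + 1)) = f m)
    (ne : f (m - 1) ≠ f m) (mid : Agree f (m - (N + 1)) (m + 1) N) :
    ∃ k, Cross f m (N + 1) k := by
  have hrep : ∀ {c p}, window f (m - (N + 1)) N = List.replicate p c →
      ∀ z, m - (N + 1) ≤ z → z < m - 1 → f z = c := by
    intro c p h z h₁ h₂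
    obtain ⟨t, ht⟩ := Int.eq_ofNat_of_zero_le (show 0 ≤ z - (m - (N + 1)) by omega)
    have h₃ := getElem_window f (m - (N + 1)) N t (by rw [length_window]; omega)
    simp only [h, List.getElem_replicate] at h₃
    rw [h₃]
    congr 1
    omega
  rw [isCentral_iff_of_ne ne] at hc
  rcases hc with ⟨p, h⟩ | ⟨p, h⟩ | ⟨s, t, hs, ht⟩
  · have hz : ∀ z, m - 1 - (N + 1) ≤ z → z ≤ m - 1 → f z = f (m - 1) := by
      intro z h₁ h₂
      rcases h₁.eq_or_lt with rfl | h₁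
      · exact left
      rcases h₂.eq_or_lt with rfl | h₂
      · rfl
      exact hrep h z (by omega) h₂
    refine ⟨1, le_rfl, by omega, left, right, ne, mid.mono, fun t h₁ h₂ => ?_, by simp⟩
    exact (hz _ (by omega) (by omega)).trans (hz _ (by omega) (by omega)).symm
  · have hz : ∀ z, m ≤ z → z ≤ m + N → f z = f m := by
      intro z h₁ h₂
      rcases h₁.eq_or_lt with rfl | h₁
      · rfl
      rw [← hrep h (z - (N + 2)) (by omega) (by omega)]
      exact mid.symm.eq
    refine ⟨N + 1, by omega, le_rfl, left, right, ne, mid.mono, fun t h₁ h₂ => ?_,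
      hz _ (by omega) (by omega)⟩
    rcases h₁.eq_or_lt with rfl | h₁
    · simpa using left.symm
    · exact (hz _ (by omega) (by omega)).trans (hrep h _ (by omega) (by omega)).symm
  · obtain ⟨s₁, s₂, s₃, s₄, hN⟩ := append_pair_append_eq_window hs.symm
    obtain ⟨t₁, t₂, t₃, t₄, -⟩ := append_pair_append_eq_window ht.symm
    have hS := window_eq_iff.1 (s₁.symm.trans t₄)
    have hT := window_eq_iff.1 (t₁.symm.trans s₄)
    have hT' := hT.symm.trans (mid.mono (i' := m - (N + 1)) (j' := m + 1) (l' := t.length))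
    refine ⟨t.length + 2, by omega, by omega, left, right, ne, mid.mono, ?_, ?_⟩
    · have a₁ : Agree f (m - 1 - (N + 1) + (t.length + 2)) (m - 1 - (N + 1)) (s.length + 1) := by
        refine hS.symm.cons' ?_
        rw [left, ← t₃]
        congr 1
        ring
      have a₂ : Agree f (m - 1 - (N + 1) + (t.length + 2)) (m - 1 - (N + 1)) (s.length + 3) := by
        refine (a₁.succ (p := m - 1) s₂.symm).snoc (p := m) s₃.symm
      intro z h₁ h₂
      by_cases hz : z < s.length + 3
      · exact a₂ z h₁ hz
      · exact hT'.symm.eq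
    · rw [← t₂]
      exact mid.symm.eq

end Central

section Words

variable {f : ℤ → AB} {m i lo : ℤ} {k N P Q n : ℕ}

lemma append_eq_window_iff {u v : Word} :
    u ++ v = window f i n ↔ u.length + v.length = n ∧ u = window f i u.length ∧
      v = window f (i + u.length) v.length := by
  constructor
  · intro h
    have hn := congrArg List.length h
    rw [List.length_append, length_window] at hn
    exact ⟨hn, append_eq_window h⟩
  · rintro ⟨rfl, h₁, h₂⟩
    rw [window_add, ← h₁, ← h₂]

lemma singleton_eq_window_iff {c : AB} : [c] = window f i 1 ↔ c = f i := by
  rw [window_one, List.cons.injEq, and_iff_left rfl]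

lemma append_bracket_eq_window_iff {c d : AB} {u : Word} :
    [c] ++ u ++ [d] = window f i (u.length + 2) ↔
      f i = c ∧ u = window f (i + 1) u.length ∧ f (i + 1 + u.length) = d := by
  rw [List.append_assoc, append_eq_window_iff, append_eq_window_iff]
  simp only [List.length_append, List.length_singleton, singleton_eq_window_iff, Nat.cast_one,
    true_and, eq_comm (b := f _), show 1 + (u.length + 1) = u.length + 2 by ring]

lemma isSturmian_window_iff : IsSturmian (window f lo n) ↔ ¬ ∃ k, UnbalAt f lo (lo + n) k := by
  refine not_congr ⟨?_, ?_⟩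
  · rintro ⟨u, ha, hb⟩
    obtain ⟨i, h₁, h₂, h₃⟩ := infix_window_iff.1 ha
    obtain ⟨j, h₄, h₅, h₆⟩ := infix_window_iff.1 hb
    have hl : ∀ c : AB, ([c] ++ u ++ [c]).length = u.length + 2 := fun c => by simp
    rw [hl, append_bracket_eq_window_iff] at h₃ h₆
    rw [hl] at h₂ h₅
    push_cast at h₂ h₅
    refine ⟨u.length + 1, i, j, h₁, by omega, h₄, by omega, by omega, ?_, ?_, ?_, ?_⟩
    · rw [h₃.1, ← h₃.2.2]
      congr 1
      ring
    · rw [h₆.1, ← h₆.2.2]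
      congr 1
      ring
    · rw [h₃.1, h₆.1]
      simp
    · rw [add_sub_cancel_right]
      exact window_eq_iff.1 (h₃.2.1.symm.trans h₆.2.1)
  · rintro ⟨k, i, j, h₁, h₂, h₃, h₄, h⟩
    wlog hi : f i = a generalizing i j
    · refine this j i h₃ h₄ h₁ h₂ h.symm ?_
      have := h.ne
      cases hi' : f i <;> cases hj' : f j <;> simp_all
    have hj : f j = b := by
      have := h.ne
      cases hj' : f j <;> simp_all
    obtain ⟨h₀, h₅, h₆, -, h₇⟩ := h
    obtain ⟨l, hl⟩ := Int.eq_ofNat_of_zero_le (show 0 ≤ k - 1 by omega)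
    obtain rfl : k = l + 1 := by omega
    rw [add_sub_cancel_right] at h₇
    refine ⟨window f (i + 1) l, infix_window_iff.2 ⟨i, h₁, ?_, ?_⟩,
      infix_window_iff.2 ⟨j, h₃, ?_, ?_⟩⟩
    · simp
      omega
    · refine Eq.trans (append_bracket_eq_window_iff.2 ?_) (congrArg _ (by simp))
      simp [hi]
      rw [← hi, h₅]
      congr 1
      ring
    · simp
      omega
    · rw [window_eq_iff.2 h₇]
      refine Eq.trans (append_bracket_eq_window_iff.2 ?_) (congrArg _ (by simp))
      simp [hj]
      rw [← hj, h₆]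
      congr 1
      ring

lemma Cross.minPeriod_left (h : Cross f m (N + 1) k) :
    minPeriod (window f (m - (N + 1)) (N + 1)) = k := by
  have h₁ := h.one_le
  have h₂ := h.le
  refine (minPeriod_window_eq_iff (by omega)).2 ⟨by omega, by omega, ?_, fun d hd₀ hd hA => ?_⟩
  · exact h.shift.mono
  · exact h.not_agree_of_lt_left (d := d) (by omega) (by omega) hA.mono

lemma Cross.minPeriod_right (h : Cross f m (N + 1) k) :
    minPeriod (window f m (N + 1)) = N + 2 - k := by
  have h₁ := h.one_le
  have h₂ := h.le
  have h₃ := h.toShape.per_right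
  refine (minPeriod_window_eq_iff (by omega)).2 ⟨by omega, by omega, ?_, fun d hd₀ hd hA => ?_⟩
  · exact h₃.mono
  · exact h.not_agree_of_lt_right (d := d) (by omega) (by omega) hA.mono

lemma exists_shape_iff (hm : m = P + N + 2) (left : f (m - 1 - (N + 1)) = f (m - 1))
    (right : f (m + (N + 1)) = f m) (ne : f (m - 1) ≠ f m)
    (mid : Agree f (m - (N + 1)) (m + 1) N) :
    (∃ k, Shape f m (N + 1) k 0 (m + N + 2 + Q)) ↔ IsCentral (window f (m - (N + 1)) N) ∧
      minPeriod (window f 0 (P + N + 2)) = minPeriod (window f (m - (N + 1)) (N + 1)) ∧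
      minPeriod (window f m (N + 2 + Q)) = minPeriod (window f m (N + 1)) := by
  constructor
  · rintro ⟨k, h⟩
    obtain ⟨hc, -, -, hl, hr⟩ := h
    have h₁ := hc.one_le
    have h₂ := hc.le
    lift k to ℕ using by omega
    refine ⟨hc.isCentral, ?_, ?_⟩
    · rw [hc.minPeriod_left]
      refine (minPeriod_window_eq_iff (by omega)).2
        ⟨by omega, by omega, hl.mono, fun d hd₀ hd hA => ?_⟩
      exact hc.not_agree_of_lt_left (d := d) (by omega) (by omega) hA.mono
    · rw [hc.minPeriod_right]
      refine (minPeriod_window_eq_iff (by omega)).2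
        ⟨by omega, by omega, hr.mono, fun d hd₀ hd hA => ?_⟩
      exact hc.not_agree_of_lt_right (d := d) (by omega) (by omega) hA.mono
  · rintro ⟨hu, hl, hr⟩
    obtain ⟨k, hc⟩ := exists_cross_of_isCentral hu left right ne mid
    have h₁ := hc.one_le
    have h₂ := hc.le
    lift k to ℕ using by omega
    rw [hc.minPeriod_left, minPeriod_window_eq_iff (by omega)] at hl
    rw [hc.minPeriod_right, minPeriod_window_eq_iff (by omega)] at hr
    exact ⟨k, hc, by omega, by omega, hl.2.2.1.mono, hr.2.2.1.mono⟩

lemma Shape.isTrapezoidal_and_not_isSturmian {k n m : ℤ} {N : ℕ} (h : Shape f m n k lo (lo + N)) :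
    IsTrapezoidal (window f lo N) ∧ ¬ IsSturmian (window f lo N) := by
  refine ⟨?_, ?_⟩
  · have := h.Rp_eq_and_Kp_eq
    unfold IsTrapezoidal
    rw [length_window]
    omega
  · rw [isSturmian_window_iff, not_not]
    obtain ⟨⟨h₁, h₂, h₃, h₄, h₅, h₆, -⟩, h₇, h₈, -⟩ := h
    refine ⟨n, m - 1 - n, m, h₇, by omega, by omega, h₈, by omega, ?_, h₄.symm, by rwa [h₃],
      h₆.mono⟩
    rw [h₃, sub_add_cancel]

lemma append_eq_window_zero_iff {p u q : Word} {x y : AB} (hm : m = p.length + u.length + 2) :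
    p ++ [x] ++ u ++ [x] ++ [y] ++ u ++ [y] ++ q = window f 0 n ↔
      m + u.length + 2 + q.length = n ∧ p = window f 0 p.length ∧
        x = f (m - 1 - (u.length + 1)) ∧ u = window f (m - (u.length + 1)) u.length ∧
        x = f (m - 1) ∧ y = f m ∧ u = window f (m + 1) u.length ∧ y = f (m + (u.length + 1)) ∧
        q = window f (m + u.length + 2) q.length := by
  have e₁ : f p.length = f (m - 1 - (u.length + 1)) := by
    congr 1
    omega
  have e₂ : (p.length : ℤ) + 1 = m - (u.length + 1) := by omega
  have e₃ : m - (u.length + 1) + u.length = m - 1 := by ring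
  have e₄ : m + 1 + u.length = m + (u.length + 1) := by ring
  have e₅ : m + (u.length + 1) + 1 = m + u.length + 2 := by ring
  simp only [List.append_assoc, append_eq_window_iff, singleton_eq_window_iff, zero_add,
    List.length_append, List.length_singleton, Nat.cast_one, true_and, e₁, e₂, e₃,
    sub_add_cancel, e₄, e₅]
  refine and_congr_left' ?_
  omega

end Words

lemma exists_shape_iff_of_append_eq_window {f : ℤ → AB} {n : ℕ} {p u q : Word} {x y : AB}
    (hxy : x ≠ y) (h : p ++ [x] ++ u ++ [x] ++ [y] ++ u ++ [y] ++ q = window f 0 n) :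
    (∃ k, Shape f (p.length + u.length + 2) (u.length + 1) k 0 (0 + n)) ↔ IsCentral u ∧
      minPeriod (p ++ [x] ++ u ++ [x]) = minPeriod (u ++ [x]) ∧
      minPeriod ([y] ++ u ++ [y] ++ q) = minPeriod ([y] ++ u) := by
  obtain ⟨m, hm⟩ : ∃ m : ℤ, m = p.length + u.length + 2 := ⟨_, rfl⟩
  have hA := (append_eq_window_zero_iff hm).1 h
  obtain ⟨hn, hp, x₁, u₁, x₂, y₁, u₂, y₂, hq⟩ := hA
  have e₁ : p ++ [x] ++ u ++ [x] = window f 0 (p.length + u.length + 2) := by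
    refine (append_eq_window (f := f) (i := 0) (v := [y] ++ u ++ [y] ++ q) (n := n) ?_).1.trans ?_
    · simpa using h
    · congr 1
      simp
      ring
  have e₂ : [y] ++ u ++ [y] ++ q = window f m (u.length + 2 + q.length) := by
    refine (append_eq_window (f := f) (u := p ++ [x] ++ u ++ [x]) (i := 0) (n := n) ?_).2.trans ?_
    · simpa using h
    · congr 1
      · simp
        omega
      · simp
        ring
  have e₃ : u ++ [x] = window f (m - (u.length + 1)) (u.length + 1) := by
    refine append_eq_window_iff.2 ⟨rfl, u₁, singleton_eq_window_iff.2 (x₂.trans ?_)⟩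
    congr 1
    ring
  have e₄ : [y] ++ u = window f m (u.length + 1) :=
    append_eq_window_iff.2 ⟨add_comm _ _, singleton_eq_window_iff.2 y₁, u₂⟩
  have := exists_shape_iff (f := f) (Q := q.length) hm (x₁.symm.trans x₂) (y₂.symm.trans y₁)
    (by rwa [← x₂, ← y₁]) (window_eq_iff.1 (u₁.symm.trans u₂))
  rwa [← e₁, ← e₂, ← e₃, ← e₄, ← u₁, hn, hm, ← zero_add (n : ℤ)] at this

/-- characterization of trapezoidal non-Sturmian words (de Luca–D'Alessandro),
together with the values of `R` and `K` for any such decomposition. -/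
theorem trapezoidal_non_sturmian_characterization (w : Word) :
    (IsTrapezoidal w ∧ ¬ IsSturmian w ↔
      ∃ (p u q : Word) (x y : AB), x ≠ y ∧ IsCentral u ∧
        w = p ++ [x] ++ u ++ [x] ++ [y] ++ u ++ [y] ++ q ∧
        minPeriod (p ++ [x] ++ u ++ [x]) = minPeriod (u ++ [x]) ∧
        minPeriod ([y] ++ u ++ [y] ++ q) = minPeriod ([y] ++ u)) ∧
    (∀ (p u q : Word) (x y : AB), x ≠ y → IsCentral u →
        w = p ++ [x] ++ u ++ [x] ++ [y] ++ u ++ [y] ++ q →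
        minPeriod (p ++ [x] ++ u ++ [x]) = minPeriod (u ++ [x]) →
        minPeriod ([y] ++ u ++ [y] ++ q) = minPeriod ([y] ++ u) →
        Rp w = (p ++ [x] ++ u ++ [x]).length ∧ Kp w = ([y] ++ u ++ [y] ++ q).length) := by
  obtain ⟨f, hf⟩ := exists_eq_window w 0
  have key : ∀ {p u q : Word} {x y : AB}, x ≠ y → IsCentral u →
      w = p ++ [x] ++ u ++ [x] ++ [y] ++ u ++ [y] ++ q →
      minPeriod (p ++ [x] ++ u ++ [x]) = minPeriod (u ++ [x]) →
      minPeriod ([y] ++ u ++ [y] ++ q) = minPeriod ([y] ++ u) →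
      ∃ k, Shape f (p.length + u.length + 2) (u.length + 1) k 0 (0 + w.length) :=
    fun hxy hu hw hl hr =>
      (exists_shape_iff_of_append_eq_window hxy (hw.symm.trans hf)).2 ⟨hu, hl, hr⟩
  refine ⟨⟨?_, ?_⟩, ?_⟩
  · rintro ⟨ht, hs⟩
    rw [hf, isTrapezoidal_window_iff] at ht
    rw [hf, isSturmian_window_iff, not_not] at hs
    obtain ⟨m, n, k, h⟩ := ht.exists_shape hs
    have h₁ := h.one_le
    have h₂ := h.le
    have h₃ := h.lo_le
    have h₄ := h.lt_hi
    obtain ⟨N, hN⟩ := Int.eq_ofNat_of_zero_le (show 0 ≤ n - 1 by omega)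
    obtain ⟨P, hP⟩ := Int.eq_ofNat_of_zero_le (show 0 ≤ m - 1 - n by omega)
    obtain ⟨Q, hQ⟩ := Int.eq_ofNat_of_zero_le (show 0 ≤ 0 + w.length - (m + n + 1) by omega)
    obtain rfl : n = N + 1 := by omega
    have hm : m = P + N + 2 := by omega
    have hw : window f 0 P ++ [f (m - 1)] ++ window f (m - (N + 1)) N ++ [f (m - 1)] ++ [f m] ++
        window f (m - (N + 1)) N ++ [f m] ++ window f (m + N + 2) Q = window f 0 w.length := by
      have hA : Agree f (m - (N + 1)) (m + 1) N := h.mid.mono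
      rw [append_eq_window_zero_iff (m := m) (by simpa using hm)]
      simp only [length_window, true_and]
      exact ⟨by omega, h.left.symm, window_eq_iff.2 hA, h.right.symm, trivial⟩
    have := (exists_shape_iff_of_append_eq_window h.ne hw).1 (by
      simp only [length_window]
      exact ⟨k, hm ▸ h⟩)
    exact ⟨_, _, _, _, _, h.ne, this.1, hf.trans hw.symm, this.2⟩
  · rintro ⟨p, u, q, x, y, hxy, hu, hw, hl, hr⟩
    obtain ⟨k, h⟩ := key hxy hu hw hl hr
    have := h.isTrapezoidal_and_not_isSturmian
    rwa [← hf] at this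
  · intro p u q x y hxy hu hw hl hr
    obtain ⟨k, h⟩ := key hxy hu hw hl hr
    have := h.Rp_eq_and_Kp_eq
    rw [← hf] at this
    have hlen := congrArg List.length hw
    simp only [List.length_append, List.length_singleton] at hlen ⊢
    omega
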